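/- arXiv:1909.07277 — 3 statements merged into one kernel-verified Lean document; each statement's English description precedes it below -/
import Mathlib

section
/- The pair of statistics (asc, rep) is symmetric on the set of inversion sequences of length n: the number of inversion sequences s of length n with asc(s) = a and rep(s) = b equals the number with asc(s) = b and rep(s) = a. -/
def ascN (s : List ℕ) : ℕ :=
  ((Finset.range (s.length - 1)).filter fun i => s.getD i 0 < s.getD (i+1) 0).card

def repN (s : List ℕ) : ℕ := s.length - s.dedup.length

def zeroN (s : List ℕ) : ℕ :=
  ((Finset.range s.length).filter fun i => s.getD i 0 = 0).card

def maxN (s : List ℕ) : ℕ :=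
  ((Finset.range s.length).filter fun i => s.getD i 0 = i).card

def rminN (s : List ℕ) : ℕ :=
  ((Finset.range s.length).filter fun i =>
    ∀ j ∈ Finset.range s.length, i < j → s.getD i 0 < s.getD j 0).card

/-- `s` is an inversion sequence: 0-indexed, `s i ≤ i` (i.e. 1-indexed `0 ≤ s_i < i`). -/
def IsInvSeq (s : List ℕ) : Prop := ∀ i < s.length, s.getD i 0 ≤ i

/-- `s` is an ascent sequence. -/
def IsAscSeq (s : List ℕ) : Prop :=
  IsInvSeq s ∧ ∀ i < s.length, s.getD i 0 ≤ ascN (s.take i) + 1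

def AscSeqs (n : ℕ) : Set (List ℕ) := {s | IsAscSeq s ∧ s.length = n}

/-- The bivariate series `∑ choose (k * l) m * X ^ m * t ^ l`, as a series in `X` over `ℤ⟦t⟧`. -/
noncomputable def chooseSeries (k : ℕ) : PowerSeries (PowerSeries ℤ) :=
  PowerSeries.mk fun m => PowerSeries.mk fun l => ((k * l).choose m : ℤ)

/-- The series `1 - t * (1 + X) ^ k`. -/
noncomputable def oneSubSeries (k : ℕ) : PowerSeries (PowerSeries ℤ) :=
  1 - PowerSeries.C (PowerSeries.X : PowerSeries ℤ) * (1 + PowerSeries.X) ^ k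

/-- The ratio of `oneSubSeries k` and `oneSubSeries (k + 1)`. -/
noncomputable def ratioSeries (k : ℕ) : PowerSeries (PowerSeries ℤ) :=
  oneSubSeries k * chooseSeries (k + 1)

/-- Lists `t` of length `n` with `t i ≤ p + i`. -/
def boundedLists : ℕ → ℕ → Finset (List ℕ)
  | _, 0 => {[]}
  | p, n + 1 => (Finset.range (p + 1) ×ˢ boundedLists (p + 1) n).image fun z => z.1 :: z.2

/-- The number of ascents of `v :: t`. -/
def ascFrom : ℕ → List ℕ → ℕ
  | _, [] => 0
  | v, x :: t => (if v < x then 1 else 0) + ascFrom x t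

/-- A signed sum over the sets `J` of integers beyond `p` such that `t` has all its entries
in `C ∪ J`. -/
noncomputable def coverWeight : ℕ → Finset ℕ → List ℕ → PowerSeries ℤ
  | _, C, [] => (PowerSeries.mk 1) ^ C.card
  | p, C, x :: t =>
    if x ∈ C then coverWeight (p + 1) (insert (p + 1) C) t - coverWeight (p + 1) C t else 0

theorem coeff_one_add_X_pow' {R : Type*} [CommRing R] (k m : ℕ) :
    PowerSeries.coeff m ((1 + PowerSeries.X : PowerSeries R) ^ k) = (k.choose m : R) := by
  have h : ((1 + PowerSeries.X : PowerSeries R) ^ k) =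
      (((1 + Polynomial.X : Polynomial R) ^ k : Polynomial R) : PowerSeries R) := by
    simp
  rw [h, Polynomial.coeff_coe, Polynomial.coeff_one_add_X_pow]

theorem oneSubSeries_mul_chooseSeries (k : ℕ) : oneSubSeries k * chooseSeries k = 1 := by
  have key : PowerSeries.C (PowerSeries.X : PowerSeries ℤ) *
      ((1 + PowerSeries.X) ^ k * chooseSeries k) = chooseSeries k - 1 := by
    ext m l
    rw [PowerSeries.coeff_C_mul]
    cases l with
    | zero =>
      rw [PowerSeries.coeff_zero_X_mul]
      cases m <;> simp [chooseSeries, PowerSeries.coeff_one]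
    | succ l =>
      rw [PowerSeries.coeff_succ_X_mul, PowerSeries.coeff_mul, map_sum]
      have h1 : PowerSeries.coeff (l + 1) (PowerSeries.coeff m (chooseSeries k - 1)) =
          ((k + k * l).choose m : ℤ) := by
        have : k * (l + 1) = k + k * l := by ring
        simp only [chooseSeries, map_sub, PowerSeries.coeff_mk, PowerSeries.coeff_one, this]
        split_ifs <;> simp [PowerSeries.coeff_one]
      rw [h1, Nat.add_choose_eq]
      push_cast
      refine Finset.sum_congr rfl fun ij _ => ?_
      rw [coeff_one_add_X_pow', chooseSeries, PowerSeries.coeff_mk,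
        ← map_natCast (PowerSeries.C : ℤ →+* PowerSeries ℤ), PowerSeries.coeff_C_mul,
        PowerSeries.coeff_mk]
  rw [oneSubSeries, sub_mul, mul_assoc, key]
  ring

theorem chooseSeries_mul_ratioSeries (k : ℕ) :
    chooseSeries k * ratioSeries k = chooseSeries (k + 1) := by
  rw [ratioSeries, ← mul_assoc, mul_comm (chooseSeries k), oneSubSeries_mul_chooseSeries, one_mul]

theorem ratioSeries_eq (k : ℕ) :
    ratioSeries k = 1 + PowerSeries.X * (chooseSeries k - 1) * ratioSeries k := by
  have h0 := chooseSeries_mul_ratioSeries k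
  have h1 := oneSubSeries_mul_chooseSeries (k + 1)
  have h2 : oneSubSeries (k + 1) = (1 + PowerSeries.X) * oneSubSeries k - PowerSeries.X := by
    simp only [oneSubSeries]; ring
  rw [h2] at h1
  have h3 : ratioSeries k = oneSubSeries k * chooseSeries (k + 1) := rfl
  linear_combination h1 - PowerSeries.X * h0 + (1 + PowerSeries.X) * h3

theorem constantCoeff_chooseSeries (k : ℕ) :
    PowerSeries.constantCoeff (chooseSeries k) = PowerSeries.mk 1 := by
  rw [← PowerSeries.coeff_zero_eq_constantCoeff_apply]
  ext l
  simp [chooseSeries]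

theorem constantCoeff_ratioSeries (k : ℕ) :
    PowerSeries.constantCoeff (ratioSeries k) = 1 := by
  rw [ratioSeries_eq]
  simp

theorem chooseSeries_zero : chooseSeries 0 = PowerSeries.C (PowerSeries.mk 1) := by
  ext m l
  cases m with
  | zero => simp [chooseSeries]
  | succ m => simp [chooseSeries]

theorem ratioSeries_pow_card (k : ℕ) (S : Finset ℕ) :
    ratioSeries k ^ S.card = 1 + ∑ x ∈ S,
      PowerSeries.X * (chooseSeries k - 1) * ratioSeries k ^ (S.filter (· ≤ x)).card := by
  induction S using Finset.induction_on_max with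
  | empty => simp
  | insert m S hm ih =>
    have hmS : m ∉ S := fun h => lt_irrefl _ (hm m h)
    rw [Finset.sum_insert hmS, Finset.card_insert_of_notMem hmS]
    have h1 : (insert m S).filter (· ≤ m) = insert m S := by
      apply Finset.filter_true_of_mem
      intro x hx
      rcases Finset.mem_insert.1 hx with rfl | hx
      · exact le_rfl
      · exact (hm x hx).le
    have h2 : ∀ x ∈ S, (insert m S).filter (· ≤ x) = S.filter (· ≤ x) := by
      intro x hx
      rw [Finset.filter_insert, if_neg (not_le.2 (hm x hx))]
    rw [h1, Finset.card_insert_of_notMem hmS,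
      Finset.sum_congr rfl fun x hx => by rw [h2 x hx]]
    have h3 := ratioSeries_eq k
    rw [pow_succ]
    linear_combination ih + ratioSeries k ^ S.card * h3

theorem sum_boundedLists_succ {M : Type*} [AddCommMonoid M] (p n : ℕ) (f : List ℕ → M) :
    ∑ t ∈ boundedLists p (n + 1), f t =
      ∑ x ∈ Finset.range (p + 1), ∑ t ∈ boundedLists (p + 1) n, f (x :: t) := by
  rw [boundedLists, Finset.sum_image, Finset.sum_product]
  rintro ⟨x, t⟩ _ ⟨y, u⟩ _ h
  simpa using h

theorem mem_boundedLists {p n : ℕ} {t : List ℕ} :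
    t ∈ boundedLists p n ↔ t.length = n ∧ ∀ i < t.length, t.getD i 0 ≤ p + i := by
  induction n generalizing p t with
  | zero =>
    simp only [boundedLists, Finset.mem_singleton, List.length_eq_zero_iff]
    constructor
    · rintro rfl; simp
    · exact fun h => h.1
  | succ n ih =>
    cases t with
    | nil => simp [boundedLists]
    | cons x t =>
      simp only [boundedLists, Finset.mem_image, Finset.mem_product, Finset.mem_range, Prod.exists,
        List.cons.injEq, ih, List.length_cons]
      constructor
      · rintro ⟨x, t, ⟨hx, hn, ht⟩, rfl, rfl⟩
        refine ⟨by omega, fun i hi => ?_⟩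
        cases i with
        | zero => simp; omega
        | succ i =>
          have := ht i (by omega)
          simp only [List.getD_cons_succ]
          omega
      · rintro ⟨hn, ht⟩
        refine ⟨x, t, ⟨?_, by omega, fun i hi => ?_⟩, rfl, rfl⟩
        · have := ht 0 (by omega)
          simp at this
          omega
        · have := ht (i + 1) (by omega)
          simp only [List.getD_cons_succ] at this
          omega

theorem ascFrom_le_length (v : ℕ) (t : List ℕ) : ascFrom v t ≤ t.length := by
  induction t generalizing v with
  | nil => simp [ascFrom]
  | cons x t ih =>
    have := ih x
    simp only [ascFrom, List.length_cons]
    split_ifs <;> omega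

theorem ascN_cons (v : ℕ) (t : List ℕ) : ascN (v :: t) = ascFrom v t := by
  induction t generalizing v with
  | nil => simp [ascN, ascFrom]
  | cons x t ih =>
    rw [ascFrom, ← ih, ascN, ascN, Finset.card_filter, Finset.card_filter]
    simp only [List.length_cons, Nat.add_sub_cancel]
    rw [Finset.sum_range_succ', add_comm]
    simp

/-- The sum of the cover weights of the lists following an entry `v`, each counted with the number
of ways to cut it into `k + 1` weakly decreasing blocks. -/
noncomputable def coverSum (k n v p : ℕ) (C : Finset ℕ) : PowerSeries ℤ :=
  ∑ t ∈ boundedLists p n, ((k + n - ascFrom v t).choose n : PowerSeries ℤ) * coverWeight p C t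

theorem coverSum_succ (k n v p : ℕ) (C : Finset ℕ) (hC : ∀ x ∈ C, x ≤ p) :
    coverSum k (n + 1) v p C =
      ∑ x ∈ C.filter (· ≤ v),
        (coverSum k n x (p + 1) (insert (p + 1) C) - coverSum k n x (p + 1) C) +
      ∑ t ∈ boundedLists p (n + 1),
        ((k + n - ascFrom p t).choose (n + 1) : PowerSeries ℤ) * coverWeight p C t := by
  have hS : C.filter (· ≤ v) = (Finset.range (p + 1)).filter fun x => x ∈ C ∧ x ≤ v := by
    ext x
    simp only [Finset.mem_filter, Finset.mem_range]
    constructor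
    · rintro ⟨h1, h2⟩
      exact ⟨by have := hC x h1; omega, h1, h2⟩
    · exact fun h => h.2
  rw [hS, Finset.sum_filter, coverSum, sum_boundedLists_succ, sum_boundedLists_succ,
    ← Finset.sum_add_distrib]
  refine Finset.sum_congr rfl fun x hx => ?_
  have hxp : ¬ p < x := by simp only [Finset.mem_range] at hx; omega
  by_cases hxC : x ∈ C
  · by_cases hxv : x ≤ v
    · rw [if_pos ⟨hxC, hxv⟩, coverSum, coverSum, ← Finset.sum_sub_distrib,
        ← Finset.sum_add_distrib]
      refine Finset.sum_congr rfl fun t ht => ?_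
      have hle := ascFrom_le_length x t
      rw [(mem_boundedLists.1 ht).1] at hle
      simp only [ascFrom, coverWeight, if_pos hxC, if_neg hxp, if_neg (not_lt.2 hxv), zero_add]
      have h1 : k + (n + 1) - ascFrom x t = (k + n - ascFrom x t) + 1 := by omega
      rw [h1, Nat.choose_succ_succ]
      push_cast
      ring
    · rw [if_neg fun h => hxv h.2, zero_add]
      refine Finset.sum_congr rfl fun t _ => ?_
      simp only [ascFrom, if_neg hxp, if_pos (not_le.1 hxv), zero_add]
      have h1 : k + (n + 1) - (1 + ascFrom x t) = k + n - ascFrom x t := by omega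
      rw [h1]
  · rw [if_neg fun h => hxC h.1]
    simp [coverWeight, hxC]

theorem coverSum_eq (k n v p : ℕ) (C : Finset ℕ) (hC : ∀ x ∈ C, x ≤ p) :
    coverSum k n v p C = PowerSeries.coeff n
      (chooseSeries k ^ C.card * ratioSeries k ^ (C.filter (· ≤ v)).card) := by
  induction k using Nat.strong_induction_on generalizing n v p C with
  | _ k ihk =>
    induction n generalizing v p C with
    | zero =>
      simp [coverSum, boundedLists, coverWeight, constantCoeff_chooseSeries,
        constantCoeff_ratioSeries]
    | succ n ihn =>
      have hnext : ∑ t ∈ boundedLists p (n + 1),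
          ((k + n - ascFrom p t).choose (n + 1) : PowerSeries ℤ) * coverWeight p C t =
          PowerSeries.coeff (n + 1) (chooseSeries k ^ C.card) := by
        cases k with
        | zero =>
          rw [chooseSeries_zero, ← map_pow, PowerSeries.coeff_C, if_neg (Nat.succ_ne_zero n)]
          refine Finset.sum_eq_zero fun t _ => ?_
          rw [Nat.choose_eq_zero_of_lt (by omega), Nat.cast_zero, zero_mul]
        | succ k =>
          rw [← chooseSeries_mul_ratioSeries, mul_pow]
          have h := ihk k (Nat.lt_succ_self k) (n + 1) p p C hC
          rw [Finset.filter_true_of_mem hC] at h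
          rw [← h, coverSum]
          refine Finset.sum_congr rfl fun t _ => ?_
          rw [Nat.add_right_comm k 1 n, Nat.add_assoc k n 1]
      rw [coverSum_succ k n v p C hC, hnext, ratioSeries_pow_card, mul_add, mul_one, map_add,
        add_comm, Finset.mul_sum, map_sum]
      congr 1
      refine Finset.sum_congr rfl fun x hx => ?_
      obtain ⟨hxC, hxv⟩ := Finset.mem_filter.1 hx
      have hxp := hC x hxC
      have hpC : p + 1 ∉ C := fun h => by have := hC _ h; omega
      rw [ihn x (p + 1) C fun y hy => (hC y hy).trans (Nat.le_succ p),
        ihn x (p + 1) (insert (p + 1) C) fun y hy => by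
          rcases Finset.mem_insert.1 hy with rfl | hy
          · exact le_rfl
          · exact (hC y hy).trans (Nat.le_succ p),
        Finset.card_insert_of_notMem hpC, Finset.filter_insert, if_neg (by omega),
        Finset.filter_filter, ← map_sub]
      have hf : (C.filter fun y => y ≤ v ∧ y ≤ x) = C.filter (· ≤ x) :=
        Finset.filter_congr fun y _ => ⟨fun h => h.2, fun h => ⟨h.trans hxv, h⟩⟩
      rw [hf, ← PowerSeries.coeff_succ_X_mul]
      congr 1
      ring

theorem coverWeight_eq (p : ℕ) (C : Finset ℕ) (t : List ℕ) (hC : ∀ x ∈ C, x ≤ p)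
    (ht : t ∈ boundedLists p t.length) :
    coverWeight p C t = if ∀ x ∈ t, x ≤ p → x ∈ C then
      (PowerSeries.mk 1) ^ (C.card + t.length) *
        PowerSeries.X ^ (t.length - (t.toFinset.filter (p < ·)).card) else 0 := by
  induction t generalizing p C with
  | nil => simp [coverWeight]
  | cons x t ih =>
    have hxt : x ≤ p ∧ t ∈ boundedLists (p + 1) t.length := by
      simpa [boundedLists, Nat.lt_succ_iff] using ht
    obtain ⟨hxp, ht'⟩ := hxt
    by_cases hxC : x ∈ C
    swap
    · rw [coverWeight, if_neg hxC, if_neg]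
      exact fun h => hxC (h x List.mem_cons_self hxp)
    have hpC : p + 1 ∉ C := fun h => by have := hC _ h; omega
    rw [coverWeight, if_pos hxC, ih (p + 1) C (fun y hy => (hC y hy).trans (Nat.le_succ p)) ht',
      ih (p + 1) (insert (p + 1) C) (fun y hy => by
        rcases Finset.mem_insert.1 hy with rfl | hy
        · exact le_rfl
        · exact (hC y hy).trans (Nat.le_succ p)) ht',
      Finset.card_insert_of_notMem hpC]
    have hd : (t.toFinset.filter (p + 1 < ·)).card ≤ t.length :=
      (Finset.card_filter_le _ _).trans t.toFinset_card_le
    have hx : ((x :: t).toFinset.filter (p < ·)) = t.toFinset.filter (p < ·) := by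
      rw [List.toFinset_cons, Finset.filter_insert, if_neg (by omega)]
    rw [hx]
    by_cases hP : ∀ y ∈ t, y ≤ p → y ∈ C
    swap
    · rw [if_neg, if_neg, if_neg, sub_zero]
      · exact fun h => hP fun y hy => h y (List.mem_cons_of_mem _ hy)
      · exact fun h => hP fun y hy hyp => h y hy (by omega)
      · intro h
        refine hP fun y hy hyp => ?_
        rcases Finset.mem_insert.1 (h y hy (by omega)) with h1 | h1
        · omega
        · exact h1
    have hP' : ∀ y ∈ x :: t, y ≤ p → y ∈ C := by
      intro y hy hyp
      rcases List.mem_cons.1 hy with rfl | hy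
      · exact hxC
      · exact hP y hy hyp
    have hP'' : ∀ y ∈ t, y ≤ p + 1 → y ∈ insert (p + 1) C := by
      intro y hy hyp
      rcases Nat.le_succ_iff.1 hyp with h | h
      · exact Finset.mem_insert_of_mem (hP y hy h)
      · exact Finset.mem_insert.2 (Or.inl h)
    rw [if_pos hP', if_pos hP'', List.length_cons]
    by_cases hpt : p + 1 ∈ t
    · have hcard : t.toFinset.filter (p < ·) =
          insert (p + 1) (t.toFinset.filter (p + 1 < ·)) := by
        ext y
        simp only [Finset.mem_filter, Finset.mem_insert, List.mem_toFinset]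
        constructor
        · rintro ⟨h1, h2⟩
          by_cases h : y = p + 1
          · exact Or.inl h
          · exact Or.inr ⟨h1, by omega⟩
        · rintro (rfl | ⟨h1, h2⟩)
          · exact ⟨hpt, by omega⟩
          · exact ⟨h1, by omega⟩
      rw [if_neg fun h => hpC (h _ hpt le_rfl), hcard, Finset.card_insert_of_notMem (by simp),
        sub_zero, Nat.add_sub_add_right, Nat.add_right_comm, Nat.add_assoc]
    · have hcard : t.toFinset.filter (p < ·) = t.toFinset.filter (p + 1 < ·) := by
        refine Finset.filter_congr fun y hy => ?_
        have : y ≠ p + 1 := fun h => hpt (h ▸ List.mem_toFinset.1 hy)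
        omega
      rw [if_pos, hcard, Nat.sub_add_comm hd]
      · have hgeom : (PowerSeries.mk 1 : PowerSeries ℤ) * (1 - PowerSeries.X) = 1 :=
          PowerSeries.mk_one_mul_one_sub_eq_one ℤ
        rw [Nat.add_right_comm, ← Nat.add_assoc, pow_succ, pow_succ]
        linear_combination (PowerSeries.mk 1 : PowerSeries ℤ) ^ (C.card + t.length) *
          PowerSeries.X ^ (t.length - (t.toFinset.filter (p + 1 < ·)).card) * hgeom
      · intro y hy hyp
        refine hP y hy ?_
        have : y ≠ p + 1 := fun h => hpt (h ▸ hy)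
        omega

theorem repN_le_length (s : List ℕ) : repN s ≤ s.length := Nat.sub_le _ _

theorem sum_choose_mul_choose (n k l : ℕ) (hn : 0 < n) :
    ∑ s ∈ boundedLists 0 n, (k + n - ascN s).choose n * (l + n - repN s).choose n =
      ((k + 1) * (l + 1)).choose n := by
  have h := coverSum_eq k n 0 0 {0} (by simp)
  have h0 : ({0} : Finset ℕ).filter (· ≤ 0) = {0} := by simp
  rw [h0, Finset.card_singleton, pow_one, pow_one, chooseSeries_mul_ratioSeries, coverSum,
    chooseSeries, PowerSeries.coeff_mk] at h
  have h1 := congrArg (PowerSeries.coeff (l + 1)) h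
  rw [PowerSeries.coeff_mk, map_sum] at h1
  zify
  rw [← h1]
  refine Finset.sum_congr rfl fun s hs => ?_
  have hs' := mem_boundedLists.1 hs
  obtain ⟨hlen, hb⟩ := hs'
  cases s with
  | nil => simp at hlen; omega
  | cons x t =>
    have hx : x = 0 := by simpa using hb 0 (by simp)
    subst hx
    have hcond : ∀ y ∈ 0 :: t, y ≤ 0 → y ∈ ({0} : Finset ℕ) := by
      intro y _ hy
      simpa using hy
    rw [coverWeight_eq 0 {0} (0 :: t) (by simp) (by rw [hlen]; exact hs), if_pos hcond, hlen,
      Finset.card_singleton, ascN_cons, ascFrom, if_neg (lt_irrefl 0), zero_add]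
    have hcard : (0 :: t).dedup.length = ((0 :: t).toFinset.filter (0 < ·)).card + 1 := by
      rw [← List.card_toFinset, ← Finset.card_insert_of_notMem (a := 0) (by simp)]
      congr 1
      ext y
      simp only [Finset.mem_insert, Finset.mem_filter, List.mem_toFinset, List.mem_cons]
      have := Nat.eq_zero_or_pos y
      tauto
    have hle : (0 :: t).dedup.length ≤ (0 :: t).length := (List.dedup_sublist _).length_le
    have hrep : n - ((0 :: t).toFinset.filter (0 < ·)).card = repN (0 :: t) + 1 := by
      rw [repN]
      omega
    have hrn := repN_le_length (0 :: t)
    rw [hrep, ← map_natCast (PowerSeries.C : ℤ →+* PowerSeries ℤ), PowerSeries.coeff_C_mul,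
      PowerSeries.coeff_mul_X_pow', Nat.add_comm 1 n, PowerSeries.mk_one_pow_eq_mk_choose_add]
    congr 1
    split_ifs with hl
    · rw [PowerSeries.coeff_mk]
      congr 2
      omega
    · rw [Nat.choose_eq_zero_of_lt (by omega), Nat.cast_zero]

theorem eq_zero_of_sum_mul_choose_eq_zero (n : ℕ) (f : ℕ → ℤ)
    (hf : ∀ k, ∑ a ∈ Finset.range (n + 1), f a * ((k + n - a).choose n : ℤ) = 0) :
    ∀ a ≤ n, f a = 0 := by
  intro a
  induction a using Nat.strong_induction_on with
  | _ a ih =>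
    intro ha
    have h := hf a
    rw [Finset.sum_eq_single_of_mem a (by simp; omega)] at h
    · simpa using h
    · intro b hb hba
      simp only [Finset.mem_range] at hb
      rcases lt_or_gt_of_ne hba with h1 | h1
      · rw [ih b h1 (by omega), zero_mul]
      · rw [Nat.choose_eq_zero_of_lt (by omega), Nat.cast_zero, mul_zero]

theorem ascN_le_length (s : List ℕ) : ascN s ≤ s.length := by
  cases s with
  | nil => simp [ascN]
  | cons v t =>
    rw [ascN_cons]
    exact (ascFrom_le_length v t).trans (Nat.le_succ _)

theorem sum_card_filter_mul (n : ℕ) (g : ℕ → ℕ → ℤ) :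
    ∑ a ∈ Finset.range (n + 1), ∑ b ∈ Finset.range (n + 1),
      (((boundedLists 0 n).filter fun s => ascN s = a ∧ repN s = b).card : ℤ) * g a b =
    ∑ s ∈ boundedLists 0 n, g (ascN s) (repN s) := by
  rw [← Finset.sum_product', ← Finset.sum_fiberwise_of_maps_to
    (t := Finset.range (n + 1) ×ˢ Finset.range (n + 1)) (g := fun s => (ascN s, repN s))]
  · refine Finset.sum_congr rfl fun ab _ => ?_
    rw [Finset.sum_congr (g := fun _ => g ab.1 ab.2) rfl]
    · simp [Prod.ext_iff]
    · intro s hs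
      obtain ⟨_, rfl⟩ := Finset.mem_filter.1 hs
      rfl
  · intro s hs
    have hlen := (mem_boundedLists.1 hs).1
    have h1 := ascN_le_length s
    have h2 := repN_le_length s
    simp only [Finset.mem_product, Finset.mem_range]
    omega

theorem card_filter_symmetric (n a b : ℕ) (hn : 0 < n) :
    ((boundedLists 0 n).filter fun s => ascN s = a ∧ repN s = b).card =
      ((boundedLists 0 n).filter fun s => ascN s = b ∧ repN s = a).card := by
  by_cases hab : a ≤ n ∧ b ≤ n
  · let M : ℕ → ℕ → ℤ := fun a b =>
      (((boundedLists 0 n).filter fun s => ascN s = a ∧ repN s = b).card : ℤ)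
    have hM : ∀ k l : ℕ, ∑ a ∈ Finset.range (n + 1), ∑ b ∈ Finset.range (n + 1),
        M a b * (((k + n - a).choose n : ℤ) * ((l + n - b).choose n : ℤ)) =
        (((k + 1) * (l + 1)).choose n : ℤ) := by
      intro k l
      rw [← sum_choose_mul_choose n k l hn]
      push_cast
      exact sum_card_filter_mul n fun a b => ((k + n - a).choose n : ℤ) * (l + n - b).choose n
    have key : ∀ l, ∀ a ≤ n, ∑ b ∈ Finset.range (n + 1),
        (M a b - M b a) * ((l + n - b).choose n : ℤ) = 0 := by
      intro l
      apply eq_zero_of_sum_mul_choose_eq_zero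
      intro k
      have h1 := hM k l
      have h2 := hM l k
      rw [Finset.sum_comm, mul_comm (l + 1)] at h2
      rw [← sub_eq_zero.2 (h1.trans h2.symm), ← Finset.sum_sub_distrib]
      refine Finset.sum_congr rfl fun a _ => ?_
      rw [← Finset.sum_sub_distrib, Finset.sum_mul]
      refine Finset.sum_congr rfl fun b _ => ?_
      ring
    have h := eq_zero_of_sum_mul_choose_eq_zero n (fun b => M a b - M b a)
      (fun l => key l a hab.1) b hab.2
    exact Nat.cast_injective (R := ℤ) (sub_eq_zero.1 h)
  · rw [Finset.filter_false_of_mem, Finset.filter_false_of_mem]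
    all_goals
      intro s hs
      have hlen := (mem_boundedLists.1 hs).1
      have h1 := ascN_le_length s
      have h2 := repN_le_length s
      omega

theorem ncard_setOf_isInvSeq (n a b : ℕ) :
    {s : List ℕ | IsInvSeq s ∧ s.length = n ∧ ascN s = a ∧ repN s = b}.ncard =
      ((boundedLists 0 n).filter fun s => ascN s = a ∧ repN s = b).card := by
  rw [← Set.ncard_coe_finset]
  congr 1
  ext s
  simp only [Set.mem_ofPred_eq, Finset.coe_filter, mem_boundedLists, IsInvSeq, zero_add]
  tauto

/-- The pair `(asc, rep)` is symmetric on inversion sequences of length `n`. -/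
theorem asc_rep_symmetric_inversion (n a b : ℕ) :
    {s : List ℕ | IsInvSeq s ∧ s.length = n ∧ ascN s = a ∧ repN s = b}.ncard =
    {s : List ℕ | IsInvSeq s ∧ s.length = n ∧ ascN s = b ∧ repN s = a}.ncard := by
  rw [ncard_setOf_isInvSeq, ncard_setOf_isInvSeq]
  rcases Nat.eq_zero_or_pos n with rfl | hn
  · simp only [boundedLists, Finset.filter_singleton]
    simp [ascN, repN, and_comm]
  · exact card_filter_symmetric n a b hn
end

section
/- For every n ≥ 1, the pair of statistics (zero, max) is symmetric on the set of ascent sequences of length n: the number of ascent sequences s of length n with zero(s) = a and max(s) = b equals the number with zero(s) = b and max(s) = a. -/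
open Finset PowerSeries

section Functional

variable {S : Type*} [CommRing S]

/-- The moments of the functional `moment`. -/
def mu (t A : S) (n : ℕ) : S :=
  (-1) ^ n * (∏ i ∈ range n, (1 - (1 - t) ^ (i + 1))) * A ^ (n + 1)

theorem mu_succ {t z A : S} (hA : A * (1 - t * z) = 1) (n : ℕ) :
    (1 - t * z) * mu t A (n + 1) = ((1 - t) ^ (n + 1) - 1) * mu t A n := by
  simp only [mu, prod_range_succ]
  linear_combination ((-1) ^ (n + 1) * (∏ i ∈ range n, (1 - (1 - t) ^ (i + 1))) *
    (1 - (1 - t) ^ (n + 1)) * A ^ (n + 1)) * hA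

theorem mu_eq_zero {t : S} {N : ℕ} (ht : t ^ N = 0) (A : S) : mu t A N = 0 := by
  have h : t ^ N ∣ ∏ i ∈ range N, (1 - (1 - t) ^ (i + 1)) := by
    simpa using prod_dvd_prod_of_dvd (fun _ => t) (fun i => 1 - (1 - t) ^ (i + 1))
      fun i (_ : i ∈ range N) => by simpa using sub_dvd_pow_sub_pow 1 (1 - t) (i + 1)
  rw [ht, zero_dvd_iff] at h
  simp [mu, h]

/-- The linear functional on power series with moments `mu t A n` for `n < N`. -/
noncomputable def moment (N : ℕ) (t A : S) : S⟦X⟧ →ₗ[S] S :=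
  ∑ n ∈ range N, mu t A n • (coeff n : S⟦X⟧ →ₗ[S] S)

theorem moment_apply (N : ℕ) (t A : S) (f : S⟦X⟧) :
    moment N t A f = ∑ n ∈ range N, mu t A n * coeff n f := by
  simp [moment]

theorem moment_C_mul (N : ℕ) (t A c : S) (f : S⟦X⟧) :
    moment N t A (C c * f) = c * moment N t A f := by
  rw [← smul_eq_C_mul, map_smul, smul_eq_mul]

theorem moment_of_X_mul_eq {N : ℕ} {t z A : S} (ht : t ^ N = 0) (hA : A * (1 - t * z) = 1)
    {f g : S⟦X⟧} (h : X * g = rescale (1 - t) f - f) :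
    moment N t A g = (1 - t * z) * moment N t A f - coeff 0 f := by
  have hg (n : ℕ) : coeff n g = ((1 - t) ^ (n + 1) - 1) * coeff (n + 1) f := by
    rw [← coeff_succ_X_mul, h, map_sub, coeff_rescale]
    ring
  have hf : moment N t A f = ∑ n ∈ range (N + 1), mu t A n * coeff n f := by
    rw [sum_range_succ, mu_eq_zero ht, zero_mul, add_zero, moment_apply]
  rw [hf, sum_range_succ', moment_apply, mul_add, mul_sum]
  have h0 : (1 - t * z) * mu t A 0 = 1 := by simpa [mu, mul_comm] using hA
  have h1 : ∀ n ∈ range N, mu t A n * coeff n g =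
      (1 - t * z) * (mu t A (n + 1) * coeff (n + 1) f) := fun n _ => by
    rw [hg]
    linear_combination -coeff (n + 1) f * mu_succ hA n
  rw [sum_congr rfl h1]
  linear_combination -coeff 0 f * h0

/-- The geometric series with ratio `c * X`. -/
def geom (c : S) : S⟦X⟧ := PowerSeries.mk fun n => c ^ n

theorem geom_mul (c : S) : geom c * (1 - C c * X) = 1 := by
  have h : geom c = rescale c (PowerSeries.mk 1) := by
    ext n
    simp [geom, coeff_rescale]
  have h' := congrArg (rescale c) (mk_one_mul_one_sub_eq_one S)
  rwa [map_mul, ← h, map_sub, map_one, rescale_X] at h'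

theorem rescale_geom (c d : S) : rescale c (geom d) = geom (c * d) := by
  ext n
  simp [geom, coeff_rescale, mul_pow]

theorem geom_relation (t : S) :
    (C (1 - t) + C t * geom (-1)) * geom (-(1 - t)) = geom (-1 : S) := by
  have h1 := geom_mul (-1 : S)
  have h2 := geom_mul (-(1 - t))
  simp only [map_neg, map_sub, map_one] at h1 h2 ⊢
  linear_combination geom (-1) * h2 - (1 - C t) * geom (-(1 - t)) * h1

theorem geom_telescope (t : S) :
    C t * X * geom (-1) * geom (-(1 - t)) = geom (-(1 - t)) - geom (-1 : S) := by
  have h1 := geom_mul (-1 : S)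
  have h2 := geom_mul (-(1 - t))
  simp only [map_neg, map_sub, map_one] at h1 h2 ⊢
  linear_combination geom (-(1 - t)) * h1 - geom (-1) * h2

/-- The series counting the completions of an ascent sequence with `a` ascents and last
letter `l` that is not strictly increasing. -/
noncomputable def completion (N : ℕ) (t A : S) (a l : ℕ) : S :=
  moment N t A (geom (-1) ^ (a + 1 - l) * geom (-(1 - t)) ^ l)

/-- The series counting the completions of the ascent sequence `0, 1, …, a`. -/
noncomputable def stairCompletion (N : ℕ) (t A B : S) (a : ℕ) : S :=
  (1 - t) * moment N t A (geom (-(1 - t)) ^ a * (C B * geom (-(1 - t) * B)))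

theorem completion_succ_right (N : ℕ) (t A : S) {a l : ℕ} (h : l ≤ a) :
    (1 - t) * completion N t A a (l + 1) + t * completion N t A (a + 1) (l + 1) =
      completion N t A a l := by
  simp only [completion, ← moment_C_mul, ← map_add]
  congr 1
  rw [show a + 1 - l = a - l + 1 by omega, show a + 1 - (l + 1) = a - l by omega,
    show a + 1 + 1 - (l + 1) = a - l + 1 by omega]
  linear_combination geom (-1) ^ (a - l) * geom (-(1 - t)) ^ l * geom_relation t

theorem completion_zero_right {N : ℕ} {t z A : S} (ht : t ^ N = 0) (hA : A * (1 - t * z) = 1)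
    (a : ℕ) : completion N t A a 0 = 1 + t * (z * completion N t A a 0 +
      ∑ x ∈ range (a + 1), completion N t A (a + 1) (x + 1)) := by
  have key := moment_of_X_mul_eq (f := geom (-1 : S) ^ (a + 1))
    (g := ∑ x ∈ range (a + 1), C t * (geom (-1) ^ (a + 1 - x) * geom (-(1 - t)) ^ (x + 1)))
    ht hA (by
      have h (x : ℕ) (hx : x ∈ range (a + 1)) :
          X * (C t * (geom (-1) ^ (a + 1 - x) * geom (-(1 - t)) ^ (x + 1))) =
          geom (-1 : S) ^ (a + 1 - (x + 1)) * geom (-(1 - t)) ^ (x + 1) -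
            geom (-1) ^ (a + 1 - x) * geom (-(1 - t)) ^ x := by
        rw [mem_range] at hx
        rw [show a + 1 - x = a - x + 1 by omega, show a + 1 - (x + 1) = a - x by omega]
        linear_combination geom (-1) ^ (a - x) * geom (-(1 - t)) ^ x * geom_telescope t
      rw [mul_sum, sum_congr rfl h,
        sum_range_sub (fun x => geom (-1 : S) ^ (a + 1 - x) * geom (-(1 - t)) ^ x), map_pow,
        rescale_geom]
      simp)
  have hc : coeff 0 (geom (-1 : S) ^ (a + 1)) = 1 := by
    rw [coeff_zero_eq_constantCoeff_apply, map_pow, ← coeff_zero_eq_constantCoeff_apply]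
    simp [geom]
  simp only [map_sum, moment_C_mul, ← mul_sum] at key
  have hs : ∑ x ∈ range (a + 1), completion N t A (a + 1) (x + 1) = ∑ x ∈ range (a + 1),
      moment N t A (geom (-1) ^ (a + 1 - x) * geom (-(1 - t)) ^ (x + 1)) :=
    sum_congr rfl fun x _ => by rw [completion, show a + 1 + 1 - (x + 1) = a + 1 - x by omega]
  rw [hs, mul_add, key, hc]
  simp only [completion, pow_zero, mul_one, Nat.sub_zero]
  ring

theorem completion_eq {N : ℕ} {t z A : S} (ht : t ^ N = 0) (hA : A * (1 - t * z) = 1)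
    {a l : ℕ} (h : l ≤ a) :
    completion N t A a l = 1 + t * ∑ x ∈ range (a + 2),
      (if x = 0 then z else 1) * completion N t A (if l < x then a + 1 else a) x := by
  induction l with
  | zero =>
    rw [sum_range_succ']
    simpa [add_comm] using completion_zero_right ht hA a
  | succ l ih =>
    have hd : ∑ x ∈ range (a + 2),
          (if x = 0 then z else 1) * completion N t A (if l < x then a + 1 else a) x -
        ∑ x ∈ range (a + 2),
          (if x = 0 then z else 1) * completion N t A (if l + 1 < x then a + 1 else a) x =
        completion N t A (a + 1) (l + 1) - completion N t A a (l + 1) := by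
      rw [← sum_sub_distrib, sum_eq_single_of_mem (l + 1) (by simp; omega)]
      · simp
      · intro x _ hx
        have : l < x ↔ l + 1 < x := by omega
        simp [this]
    linear_combination ih (by omega) + completion_succ_right N t A (a := a) (l := l) (by omega)
      + t * hd

theorem stairCompletion_sub (N : ℕ) (t v A : S) {B : S} (hB : B * (1 - t * v) = 1) (a : ℕ) :
    stairCompletion N t A B a - t * v * stairCompletion N t A B (a + 1) =
      completion N t A a a - t * completion N t A (a + 1) (a + 1) := by
  simp only [completion, stairCompletion, ← mul_assoc _ (1 - t), mul_comm _ (1 - t)]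
  simp only [mul_assoc (1 - t), ← moment_C_mul, ← map_sub]
  congr 1
  have h1 := geom_relation t
  have h2 := geom_mul (-(1 - t))
  have h3 := geom_mul (-(1 - t) * B)
  have h4 := congrArg (C : S → S⟦X⟧) hB
  rw [show a + 1 - a = 1 by omega, show a + 1 + 1 - (a + 1) = 1 by omega]
  simp only [map_neg, map_sub, map_one, map_mul] at h1 h2 h3 h4 ⊢
  set p : S⟦X⟧ := geom (-1)
  set r : S⟦X⟧ := geom (-(1 - t))
  set g : S⟦X⟧ := geom (-(1 - t) * B)
  have h5 : C B * g * (1 - C t * C v + (1 - C t) * X) = 1 := by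
    linear_combination g * h4 + h3
  have h6 : C B * g * (1 - C t * C v * r) = r := by
    linear_combination r * h5 - C B * g * h2
  linear_combination (1 - C t) * r ^ a * h6 + r ^ a * h1

theorem stairCompletion_eq {N : ℕ} {t z v A B : S} (ht : t ^ N = 0)
    (hA : A * (1 - t * z) = 1) (hB : B * (1 - t * v) = 1) (a : ℕ) :
    stairCompletion N t A B a = 1 + t * ((∑ x ∈ range (a + 1),
      (if x = 0 then z else 1) * completion N t A a x) +
      v * stairCompletion N t A B (a + 1)) := by
  have h := completion_eq ht hA (le_refl a)
  rw [sum_range_succ] at h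
  have hs : ∑ x ∈ range (a + 1), (if x = 0 then z else 1) *
      completion N t A (if a < x then a + 1 else a) x =
      ∑ x ∈ range (a + 1), (if x = 0 then z else 1) * completion N t A a x :=
    sum_congr rfl fun x hx => by rw [if_neg (show ¬a < x by rw [mem_range] at hx; omega)]
  rw [hs, if_neg (Nat.succ_ne_zero a), if_pos (Nat.lt_succ_self a), one_mul] at h
  linear_combination h + stairCompletion_sub N t v A hB a

theorem stairCompletion_zero_comm (N : ℕ) (t A B : S) :
    stairCompletion N t A B 0 = stairCompletion N t B A 0 := by
  simp only [stairCompletion, moment_apply, pow_zero, one_mul]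
  congr 1
  refine sum_congr rfl fun n _ => ?_
  simp only [coeff_C_mul, geom, coeff_mk, mu, mul_pow]
  ring

end Functional

section AscentSequences

theorem card_filter_range_append (p : ℕ → ℕ → Prop) [∀ i x, Decidable (p i x)]
    (s : List ℕ) (x : ℕ) :
    #{i ∈ range (s ++ [x]).length | p i ((s ++ [x]).getD i 0)} =
      #{i ∈ range s.length | p i (s.getD i 0)} + if p s.length x then 1 else 0 := by
  have h : ∀ i ∈ range s.length, (p i ((s ++ [x]).getD i 0) ↔ p i (s.getD i 0)) :=
    fun i hi => by rw [List.getD_append _ _ _ _ (mem_range.1 hi)]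
  rw [List.length_append, List.length_singleton, range_add_one, filter_insert, filter_congr h]
  have hx : (s ++ [x]).getD s.length 0 = x := by simp
  rw [hx]
  split_ifs <;> simp

theorem zeroN_append (s : List ℕ) (x : ℕ) :
    zeroN (s ++ [x]) = zeroN s + if x = 0 then 1 else 0 :=
  card_filter_range_append (fun _ y => y = 0) s x

theorem maxN_append (s : List ℕ) (x : ℕ) :
    maxN (s ++ [x]) = maxN s + if x = s.length then 1 else 0 :=
  card_filter_range_append (fun i y => y = i) s x

theorem ascN_append (s : List ℕ) (l x : ℕ) :
    ascN (s ++ [l] ++ [x]) = ascN (s ++ [l]) + if l < x then 1 else 0 := by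
  have hg (j : ℕ) (hj : j < s.length + 1) :
      (s ++ [l] ++ [x]).getD j 0 = (s ++ [l]).getD j 0 :=
    List.getD_append _ _ _ _ (by simpa using hj)
  have h : ∀ i ∈ range s.length, ((s ++ [l] ++ [x]).getD i 0 < (s ++ [l] ++ [x]).getD (i + 1) 0 ↔
      (s ++ [l]).getD i 0 < (s ++ [l]).getD (i + 1) 0) := fun i hi => by
    rw [mem_range] at hi
    rw [hg i (by omega), hg (i + 1) (by omega)]
  have h1 : (s ++ [l] ++ [x]).length - 1 = s.length + 1 := by simp
  have h2 : (s ++ [l]).length - 1 = s.length := by simp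
  have h3 : (s ++ [l] ++ [x]).getD s.length 0 = l := by simp
  have h4 : (s ++ [l] ++ [x]).getD (s.length + 1) 0 = x := by simp [List.getD_eq_getElem?_getD]
  rw [ascN, ascN, h1, h2, range_add_one, filter_insert, filter_congr h, h3, h4]
  split_ifs <;> simp

theorem ascN_lt_length {s : List ℕ} (hs : s ≠ []) : ascN s < s.length := by
  have h : ascN s ≤ s.length - 1 := (card_filter_le _ _).trans (card_range _).le
  have := List.length_pos_iff.2 hs
  omega

theorem isAscSeq_singleton {x : ℕ} : IsAscSeq [x] ↔ x = 0 := by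
  simpa [IsAscSeq, IsInvSeq] using fun h => h ▸ Nat.zero_le _

theorem isAscSeq_append {s : List ℕ} (hs : s ≠ []) (x : ℕ) :
    IsAscSeq (s ++ [x]) ↔ IsAscSeq s ∧ x ≤ ascN s + 1 := by
  have hx : (s ++ [x]).getD s.length 0 = x := by simp
  have hlt := ascN_lt_length hs
  have hg (i : ℕ) (hi : i < s.length) : (s ++ [x]).getD i 0 = s.getD i 0 :=
    List.getD_append _ _ _ _ hi
  have ht (i : ℕ) (hi : i < s.length) : (s ++ [x]).take i = s.take i :=
    List.take_append_of_le_length hi.le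
  simp only [IsAscSeq, IsInvSeq, List.length_append, List.length_singleton,
    Nat.forall_lt_succ_right, hx, List.take_left]
  constructor
  · rintro ⟨⟨h1, -⟩, h2, h3⟩
    refine ⟨⟨fun i hi => ?_, fun i hi => ?_⟩, h3⟩
    · simpa only [hg i hi] using h1 i hi
    · simpa only [hg i hi, ht i hi] using h2 i hi
  · rintro ⟨⟨h1, h2⟩, h3⟩
    refine ⟨⟨fun i hi => ?_, by omega⟩, fun i hi => ?_, h3⟩
    · simpa only [hg i hi] using h1 i hi
    · simpa only [hg i hi, ht i hi] using h2 i hi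

/-- The ascent sequences of length `n + 1`. -/
def ascSeqFinset : ℕ → Finset (List ℕ)
  | 0 => {[0]}
  | n + 1 => (ascSeqFinset n).biUnion fun s => (range (ascN s + 2)).image fun x => s ++ [x]

theorem mem_ascSeqFinset {n : ℕ} {s : List ℕ} :
    s ∈ ascSeqFinset n ↔ IsAscSeq s ∧ s.length = n + 1 := by
  induction n generalizing s with
  | zero =>
    rw [ascSeqFinset, mem_singleton, zero_add, List.length_eq_one_iff]
    constructor
    · rintro rfl
      exact ⟨isAscSeq_singleton.2 rfl, 0, rfl⟩
    · rintro ⟨h, x, rfl⟩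
      rw [isAscSeq_singleton.1 h]
  | succ n ih =>
    simp only [ascSeqFinset, mem_biUnion, mem_image, mem_range, ih]
    constructor
    · rintro ⟨s, ⟨hs, hl⟩, x, hx, rfl⟩
      have hne : s ≠ [] := List.ne_nil_of_length_eq_add_one hl
      exact ⟨(isAscSeq_append hne x).2 ⟨hs, by omega⟩, by simp [hl]⟩
    · rintro ⟨hs, hl⟩
      obtain rfl | ⟨s, x, rfl⟩ := List.eq_nil_or_concat' s
      · simp at hl
      have hl' : s.length = n + 1 := by simpa using hl
      have h := (isAscSeq_append (List.ne_nil_of_length_eq_add_one hl') x).1 hs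
      exact ⟨s, ⟨h.1, hl'⟩, x, by omega, rfl⟩

theorem sum_ascSeqFinset_succ {S : Type*} [AddCommMonoid S] (n : ℕ) (f : List ℕ → S) :
    ∑ s ∈ ascSeqFinset (n + 1), f s =
      ∑ s ∈ ascSeqFinset n, ∑ x ∈ range (ascN s + 2), f (s ++ [x]) := by
  rw [ascSeqFinset, sum_biUnion]
  · refine sum_congr rfl fun s _ => sum_image fun x _ y _ h => ?_
    simpa using h
  · intro s _ s' _ hne
    rw [Function.onFun, disjoint_left]
    intro u hu hu'
    obtain ⟨x, -, rfl⟩ := mem_image.1 hu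
    obtain ⟨y, -, h⟩ := mem_image.1 hu'
    exact hne (List.append_inj_left' h rfl).symm

theorem ascSeqFinset_last {n : ℕ} {s : List ℕ} (hs : s ∈ ascSeqFinset n) :
    ∃ u l, s = u ++ [l] ∧ l ≤ ascN s ∧ (ascN s = n → l = n) := by
  induction n generalizing s with
  | zero =>
    rw [ascSeqFinset, mem_singleton] at hs
    exact ⟨[], 0, hs, by simp⟩
  | succ n ih =>
    simp only [ascSeqFinset, mem_biUnion, mem_image, mem_range] at hs
    obtain ⟨s, hs, x, hx, rfl⟩ := hs
    have hlt := ascN_lt_length (List.ne_nil_of_length_eq_add_one (mem_ascSeqFinset.1 hs).2)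
    rw [(mem_ascSeqFinset.1 hs).2] at hlt
    obtain ⟨u, l, rfl, h1, h2⟩ := ih hs
    refine ⟨_, x, rfl, ?_, ?_⟩ <;> rw [ascN_append] <;> split_ifs <;> omega

end AscentSequences

section GeneratingFunction

variable {S : Type*} [CommRing S]

/-- The bivariate weight of `zeroN` and `maxN`. -/
def weight (z v : S) (s : List ℕ) : S := z ^ zeroN s * v ^ maxN s

theorem weight_append (z v : S) (s : List ℕ) (x : ℕ) :
    weight z v (s ++ [x]) =
      weight z v s * ((if x = 0 then z else 1) * if x = s.length then v else 1) := by
  rw [weight, weight, zeroN_append, maxN_append]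
  split_ifs <;> ring

/-- The series counting all completions of an ascent sequence. -/
noncomputable def potential (N : ℕ) (t A B : S) (s : List ℕ) : S :=
  if ascN s + 1 = s.length then stairCompletion N t A B (ascN s)
  else completion N t A (ascN s) (s.getLastD 0)

theorem potential_eq {N : ℕ} {t z v A B : S} (ht : t ^ N = 0)
    (hA : A * (1 - t * z) = 1) (hB : B * (1 - t * v) = 1) {n : ℕ} {s : List ℕ}
    (hs : s ∈ ascSeqFinset n) :
    potential N t A B s = 1 + t * ∑ x ∈ range (ascN s + 2),
      ((if x = 0 then z else 1) * if x = s.length then v else 1) *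
        potential N t A B (s ++ [x]) := by
  have hlen := (mem_ascSeqFinset.1 hs).2
  have hlt := ascN_lt_length (List.ne_nil_of_length_eq_add_one hlen)
  obtain ⟨u, l, rfl, hl, hln⟩ := ascSeqFinset_last hs
  simp only [potential, ascN_append]
  set a := ascN (u ++ [l])
  have hlen' (x : ℕ) : (u ++ [l] ++ [x]).length = n + 2 := by
    rw [List.length_append, hlen, List.length_singleton]
  simp only [hlen', hlen, List.getLastD_concat]
  by_cases ha : a = n
  · obtain rfl := hln ha
    rw [if_pos (by omega), sum_range_succ, stairCompletion_eq ht hA hB]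
    congr 3
    · refine sum_congr (by rw [ha]) fun x hx => ?_
      rw [mem_range] at hx
      rw [if_neg (show ¬x = l + 1 by omega), if_neg (show ¬l < x by omega), add_zero,
        if_neg (show ¬a + 1 = l + 2 by omega), mul_one]
    · rw [ha]
      simp
  · rw [if_neg (by omega), completion_eq ht hA hl]
    congr 2
    refine sum_congr rfl fun x hx => ?_
    rw [mem_range] at hx
    rw [if_neg (show ¬x = n + 1 by omega), mul_one]
    congr 1
    split_ifs <;> first | rfl | omega

theorem sum_weight_mul_potential {N : ℕ} {t z v A B : S} (ht : t ^ N = 0)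
    (hA : A * (1 - t * z) = 1) (hB : B * (1 - t * v) = 1) (n : ℕ) :
    ∑ s ∈ ascSeqFinset n, weight z v s * potential N t A B s =
      ∑ s ∈ ascSeqFinset n, weight z v s +
        t * ∑ s ∈ ascSeqFinset (n + 1), weight z v s * potential N t A B s := by
  rw [sum_ascSeqFinset_succ, mul_sum, ← sum_add_distrib]
  refine sum_congr rfl fun s hs => ?_
  rw [potential_eq ht hA hB hs, mul_add, mul_one, mul_left_comm, mul_sum]
  simp only [weight_append, mul_assoc]

theorem sum_pow_mul_weight {N : ℕ} {t z v A B : S} (ht : t ^ N = 0)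
    (hA : A * (1 - t * z) = 1) (hB : B * (1 - t * v) = 1) :
    ∑ i ∈ range N, t ^ i * ∑ s ∈ ascSeqFinset i, weight z v s =
      z * v * stairCompletion N t A B 0 := by
  have h (n : ℕ) : ∑ s ∈ ascSeqFinset 0, weight z v s * potential N t A B s =
      ∑ i ∈ range n, t ^ i * ∑ s ∈ ascSeqFinset i, weight z v s +
        t ^ n * ∑ s ∈ ascSeqFinset n, weight z v s * potential N t A B s := by
    induction n with
    | zero => simp
    | succ n ih =>
      rw [ih, sum_range_succ, sum_weight_mul_potential ht hA hB n]
      ring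
  have h0 := h N
  rw [ht, zero_mul, add_zero] at h0
  rw [← h0]
  simp [ascSeqFinset, weight, potential, zeroN, maxN, ascN, filter_singleton]

theorem sum_pow_mul_weight_comm {N : ℕ} {t : S} (ht : t ^ N = 0) (z v : S) :
    ∑ i ∈ range N, t ^ i * ∑ s ∈ ascSeqFinset i, weight z v s =
      ∑ i ∈ range N, t ^ i * ∑ s ∈ ascSeqFinset i, weight v z s := by
  have hinv (z : S) : ∃ A, A * (1 - t * z) = 1 :=
    ((Commute.all t z).isNilpotent_mul_right ⟨N, ht⟩).isUnit_one_sub.exists_left_inv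
  obtain ⟨A, hA⟩ := hinv z
  obtain ⟨B, hB⟩ := hinv v
  rw [sum_pow_mul_weight ht hA hB, sum_pow_mul_weight ht hB hA, stairCompletion_zero_comm,
    mul_comm z v]

theorem sum_weight_comm (z v : S) (n : ℕ) :
    ∑ s ∈ ascSeqFinset n, weight z v s = ∑ s ∈ ascSeqFinset n, weight v z s := by
  let I : Ideal (Polynomial S) := Ideal.span {Polynomial.X ^ (n + 1)}
  let π : Polynomial S →+* Polynomial S ⧸ I := Ideal.Quotient.mk I
  have ht : π Polynomial.X ^ (n + 1) = 0 := by
    rw [← map_pow]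
    exact Ideal.Quotient.eq_zero_iff_mem.2 (Ideal.subset_span rfl)
  have hmap (z v : S) :
      ∑ i ∈ range (n + 1), π Polynomial.X ^ i * ∑ s ∈ ascSeqFinset i,
        weight (π (Polynomial.C z)) (π (Polynomial.C v)) s =
      π (∑ i ∈ range (n + 1), Polynomial.X ^ i *
        Polynomial.C (∑ s ∈ ascSeqFinset i, weight z v s)) := by
    simp only [map_sum, map_mul, map_pow, weight]
  have h := sum_pow_mul_weight_comm ht (π (Polynomial.C z)) (π (Polynomial.C v))
  rw [hmap, hmap, Ideal.Quotient.eq, Ideal.mem_span_singleton, Polynomial.X_pow_dvd_iff] at h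
  have hcoeff (z v : S) : (∑ i ∈ range (n + 1), Polynomial.X ^ i *
      Polynomial.C (∑ s ∈ ascSeqFinset i, weight z v s)).coeff n =
      ∑ s ∈ ascSeqFinset n, weight z v s := by
    rw [Polynomial.finsetSum_coeff, sum_eq_single_of_mem n (self_mem_range_succ n)]
    · rw [Polynomial.coeff_X_pow_mul', if_pos le_rfl, Nat.sub_self, Polynomial.coeff_C_zero]
    · intro i hi hne
      rw [mem_range] at hi
      rw [Polynomial.coeff_X_pow_mul', if_pos (by omega),
        Polynomial.coeff_C_of_ne_zero (by omega)]
  have hn := h n n.lt_succ_self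
  rwa [Polynomial.coeff_sub, hcoeff, hcoeff, sub_eq_zero] at hn

end GeneratingFunction

theorem card_filter_zeroN_maxN_comm (n a b : ℕ) :
    #{s ∈ ascSeqFinset n | zeroN s = a ∧ maxN s = b} =
      #{s ∈ ascSeqFinset n | zeroN s = b ∧ maxN s = a} := by
  have h := congrArg (fun p => (p.coeff b).coeff a) (sum_weight_comm
    (Polynomial.C Polynomial.X : Polynomial (Polynomial ℤ)) Polynomial.X n)
  have h1 (i j : ℕ) : (((Polynomial.C Polynomial.X ^ i * Polynomial.X ^ j :
      Polynomial (Polynomial ℤ)).coeff b).coeff a) = if i = a ∧ j = b then 1 else 0 := by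
    rw [← Polynomial.C_pow, Polynomial.coeff_C_mul_X_pow]
    by_cases hj : b = j
    · simp [hj, Polynomial.coeff_X_pow, eq_comm (a := a)]
    · simp [hj, Ne.symm hj]
  simp only [weight, Polynomial.finsetSum_coeff, h1,
    mul_comm (Polynomial.X ^ _) (Polynomial.C Polynomial.X ^ _ : Polynomial (Polynomial ℤ))] at h
  simp only [and_comm (a := maxN _ = a), sum_boole] at h
  exact_mod_cast h

/-- The pair `(zero, max)` is symmetric on ascent sequences of length `n ≥ 1`. -/
theorem zero_max_symmetric (n : ℕ) (hn : 1 ≤ n) (a b : ℕ) :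
    {s : List ℕ | IsAscSeq s ∧ s.length = n ∧ zeroN s = a ∧ maxN s = b}.ncard =
    {s : List ℕ | IsAscSeq s ∧ s.length = n ∧ zeroN s = b ∧ maxN s = a}.ncard := by
  obtain ⟨n, rfl⟩ := Nat.exists_eq_add_of_le' hn
  have h (a b : ℕ) : {s : List ℕ | IsAscSeq s ∧ s.length = n + 1 ∧ zeroN s = a ∧ maxN s = b} =
      ({s ∈ ascSeqFinset n | zeroN s = a ∧ maxN s = b} : Finset (List ℕ)) := by
    ext s
    simp [mem_ascSeqFinset, and_assoc]
  rw [h, h, Set.ncard_coe_finset, Set.ncard_coe_finset, card_filter_zeroN_maxN_comm]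
end

section
/- For every n ≥ 1, there exists a bijection Υ from the set of ascent sequences of length n to itself such that for all s, (asc(s), rep(s), zero(s), max(s)) = (rep(Υ(s)), asc(Υ(s)), rmin(Υ(s)), zero(Υ(s))). -/
section Transfer

open Finset

variable {R : Type*} [CommRing R]

/-- The number of ascents after appending `v` to a word with `A` ascents and last letter `l`. -/
def ascStep (A l v : ℕ) : ℕ := A + if l < v then 1 else 0

open Classical in
/-- The weight of a letter `v` appended after a letter `l` to a word with set of letters `K`:
a factor `a` for an ascent, and a factor `b` for a repeated letter. -/
noncomputable def letterWt (a b : R) (l v : ℕ) (K : Set ℕ) : R :=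
  (if l < v then a else 1) * (if v ∈ K then b else 1)

/-- Sum over all ways to append a letter `v ≥ c` to an ascent sequence with `A` ascents, last
letter `l` and set of letters `K`. -/
noncomputable def letterSum (a b : R) (f : ℕ → ℕ → Set ℕ → R) (c A l : ℕ) (K : Set ℕ) : R :=
  ∑ v ∈ Ico c (A + 2), letterWt a b l v K * f (ascStep A l v) v (insert v K)

/-- Order embedding of `ℕ` into itself that omits `p`. -/
def skip (p v : ℕ) : ℕ := if v < p then v else v + 1

/-- Lower bounds after the letter `p` has been removed from the alphabet. -/
def unskip (p c : ℕ) : ℕ := if c ≤ p then c else c - 1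

theorem skip_lt_skip {p v w : ℕ} : skip p v < skip p w ↔ v < w := by
  unfold skip; split_ifs <;> omega

theorem skip_ne (p v : ℕ) : skip p v ≠ p := by
  unfold skip; split_ifs <;> omega

theorem skip_injective (p : ℕ) : Function.Injective (skip p) := fun v w h => by
  unfold skip at h; split_ifs at h <;> omega

theorem skip_zero {p : ℕ} (hp : 1 ≤ p) : skip p 0 = 0 := by
  unfold skip; split_ifs <;> omega

theorem unskip_skip_succ (p v : ℕ) : unskip p (skip p v + 1) = v + 1 := by
  unfold skip unskip; split_ifs <;> omega

theorem preimage_insert_skip (p v : ℕ) (K : Set ℕ) :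
    skip p ⁻¹' insert (skip p v) K = insert v (skip p ⁻¹' K) := by
  ext w; simp [(skip_injective p).eq_iff]

theorem ascStep_skip (p A l v : ℕ) :
    ascStep (A + 1) (skip p l) (skip p v) = ascStep A l v + 1 := by
  simp only [ascStep, skip_lt_skip]; omega

theorem letterWt_congr (a b : R) {l v l' v' : ℕ} {K K' : Set ℕ} (hl : l < v ↔ l' < v')
    (hK : v ∈ K ↔ v' ∈ K') : letterWt a b l v K = letterWt a b l' v' K' := by
  unfold letterWt
  congr 1
  · simp only [hl]
  · by_cases h : v ∈ K
    · rw [if_pos h, if_pos (hK.1 h)]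
    · rw [if_neg h, if_neg (mt hK.2 h)]

theorem letterWt_skip (a b : R) (p l v : ℕ) (K : Set ℕ) :
    letterWt a b (skip p l) (skip p v) K = letterWt a b l v (skip p ⁻¹' K) :=
  letterWt_congr a b skip_lt_skip Iff.rfl

theorem sum_Ico_skip (g : ℕ → R) {p c N : ℕ} (hp : p < N + 1) :
    ∑ v ∈ Ico c (N + 1), g v =
      (if c ≤ p then g p else 0) + ∑ v ∈ Ico (unskip p c) N, g (skip p v) := by
  have himg : (Ico (unskip p c) N).image (skip p) = (Ico c (N + 1)).erase p := by
    ext w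
    simp only [mem_image, mem_Ico, mem_erase]
    constructor
    · rintro ⟨v, hv, rfl⟩
      refine ⟨skip_ne p v, ?_⟩
      unfold unskip at hv; unfold skip
      split_ifs at * <;> omega
    · rintro ⟨hne, hw⟩
      refine ⟨unskip p w, ?_, ?_⟩
      · unfold unskip; split_ifs <;> omega
      · unfold unskip skip; split_ifs <;> omega
  rw [← sum_image (f := g) (fun v _ w _ h => skip_injective p h), himg]
  split_ifs with h
  · rw [add_sum_erase]; simp; omega
  · rw [erase_eq_of_notMem (by simp; omega), zero_add]

theorem letterSum_congr {a b : R} {f g : ℕ → ℕ → Set ℕ → R} {c A l : ℕ} {K : Set ℕ}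
    (h : ∀ v, c ≤ v → v ≤ A + 1 →
      f (ascStep A l v) v (insert v K) = g (ascStep A l v) v (insert v K)) :
    letterSum a b f c A l K = letterSum a b g c A l K := by
  refine sum_congr rfl fun v hv => ?_
  rw [mem_Ico] at hv
  rw [h v hv.1 (by omega)]

theorem letterSum_add (a b : R) (f g : ℕ → ℕ → Set ℕ → R) (c A l : ℕ) (K : Set ℕ) :
    letterSum a b (fun A l K => f A l K + g A l K) c A l K =
      letterSum a b f c A l K + letterSum a b g c A l K := by
  simp only [letterSum, mul_add, sum_add_distrib]

theorem letterSum_mul (a b r : R) (f : ℕ → ℕ → Set ℕ → R) (c A l : ℕ) (K : Set ℕ) :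
    letterSum a b (fun A l K => r * f A l K) c A l K = r * letterSum a b f c A l K := by
  simp only [letterSum, mul_sum]
  exact sum_congr rfl fun v _ => by ring

theorem letterSum_zero (a b : R) (c A l : ℕ) (K : Set ℕ) :
    letterSum a b (fun _ _ _ => 0) c A l K = 0 := by
  simp [letterSum]

theorem letterSum_sum {ι : Type*} (s : Finset ι) (a b : R) (f : ι → ℕ → ℕ → Set ℕ → R)
    (c A l : ℕ) (K : Set ℕ) :
    letterSum a b (fun A l K => ∑ i ∈ s, f i A l K) c A l K =
      ∑ i ∈ s, letterSum a b (f i) c A l K := by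
  simp only [letterSum, mul_sum]
  exact sum_comm

theorem letterSum_one (a b : R) (f : ℕ → ℕ → Set ℕ → R) (A l : ℕ) (K : Set ℕ) :
    letterSum a b f 1 A l K =
      letterWt a b l 1 K * f (ascStep A l 1) 1 (insert 1 K) + letterSum a b f 2 A l K := by
  rw [letterSum, sum_eq_sum_Ico_succ_bot (by omega)]; rfl

/-- Deleting a letter `p` that is not in `K`, for a one-letter step: `f`, `f'` and `g` stand for
the weights of the continuations with `p` unused, with `p` used and with `p` forbidden. -/
theorem letterSum_delete {a b : R} {f f' g : ℕ → ℕ → Set ℕ → R} {p c A l : ℕ} {K : Set ℕ}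
    (hpA : p ≤ A + 1) (hpK : p ∉ K)
    (hp : f (ascStep (A + 1) (skip p l) p) p (insert p K) =
      f' (ascStep (A + 1) (skip p l) p) p (insert p K))
    (h : ∀ v, b * f (ascStep A l v + 1) (skip p v) (insert (skip p v) K) =
      f' (ascStep A l v + 1) (skip p v) (insert p (insert (skip p v) K)) +
        (b - 1) * g (ascStep A l v) v (insert v (skip p ⁻¹' K))) :
    b * letterSum a b f c (A + 1) (skip p l) K =
      letterSum a b f' c (A + 1) (skip p l) (insert p K) +
        (b - 1) * letterSum a b g (unskip p c) A l (skip p ⁻¹' K) := by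
  simp only [letterSum]
  rw [sum_Ico_skip (N := A + 2) _ (p := p) (by omega),
    sum_Ico_skip (N := A + 2) _ (p := p) (by omega)]
  simp only [ascStep_skip, letterWt_skip, Set.insert_idem]
  have h1 : b * (letterWt a b (skip p l) p K * f (ascStep (A + 1) (skip p l) p) p (insert p K)) =
      letterWt a b (skip p l) p (insert p K) *
        f' (ascStep (A + 1) (skip p l) p) p (insert p K) := by
    rw [hp]; simp only [letterWt, Set.mem_insert_iff, true_or, if_true, if_neg hpK]; ring
  have h2 : ∀ v, letterWt a b l v (skip p ⁻¹' insert p K) = letterWt a b l v (skip p ⁻¹' K) := by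
    exact fun v => letterWt_congr a b Iff.rfl (by simp [skip_ne])
  rw [mul_add, mul_ite, h1, mul_zero, add_assoc, mul_sum, mul_sum, ← sum_add_distrib]
  congr 1
  refine sum_congr rfl fun v _ => ?_
  rw [h2, Set.insert_comm]
  linear_combination letterWt a b l v (skip p ⁻¹' K) * h v

theorem letterSum_avoid {a b : R} {f g : ℕ → ℕ → Set ℕ → R} {p c A l : ℕ} {K : Set ℕ}
    (hpA : p ≤ A + 1) (hpc : p < c)
    (h : ∀ v, p ≤ v → f (ascStep A l v + 1) (skip p v) (insert (skip p v) K) =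
      g (ascStep A l v) v (insert v (skip p ⁻¹' K))) :
    letterSum a b f c (A + 1) (skip p l) K = letterSum a b g (c - 1) A l (skip p ⁻¹' K) := by
  have hc : unskip p c = c - 1 := by unfold unskip; split_ifs <;> omega
  simp only [letterSum]
  rw [sum_Ico_skip (N := A + 2) _ (p := p) (by omega), if_neg (by omega), zero_add, hc]
  refine sum_congr rfl fun v hv => ?_
  rw [ascStep_skip, letterWt_skip, h v (by rw [mem_Ico] at hv; omega)]

/-- Weighted count of the ways to append `m` letters to an ascent sequence, with weight `u` for
ascents, `x` for repeated letters and `z` for zeros. -/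
noncomputable def zeroExt (u x z : R) : ℕ → ℕ → ℕ → Set ℕ → R
  | 0, _, _, _ => 1
  | m + 1, A, l, K =>
    letterSum u x (fun A l K => (if l = 0 then z else 1) * zeroExt u x z m A l K) 0 A l K

/-- The factor for a zero followed by exactly `a` further zeros. -/
def zeroWt (z : R) (a : ℕ) : R := if a = 0 then z else 1

/-- Weighted count of the ways to append `m` letters to an ascent sequence, exactly `a` of them
zeros and the others at least `c`, with weight `x` for ascents, `u` for repeated letters and `z`
for right-to-left minima. -/
noncomputable def rminExt (x u z : R) : ℕ → ℕ → ℕ → ℕ → ℕ → Set ℕ → R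
  | 0, a, _, _, _, _ => if a = 0 then 1 else 0
  | m + 1, 0, c, A, l, K =>
    letterSum x u (fun A l K =>
      rminExt x u z m 0 c A l K + (z - 1) * rminExt x u z m 0 (l + 1) A l K) c A l K
  | m + 1, a + 1, c, A, l, K =>
    letterSum x u (fun A l K => rminExt x u z m (a + 1) c A l K) c A l K +
      u * zeroWt z a * rminExt x u z m a c A 0 K

section Equations

variable (x u z : R) (m a c A l : ℕ) (K : Set ℕ)

theorem rminExt_succ_zero :
    rminExt x u z (m + 1) 0 c A l K =
      letterSum x u (fun A l K =>
        rminExt x u z m 0 c A l K + (z - 1) * rminExt x u z m 0 (l + 1) A l K) c A l K := rfl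

theorem rminExt_succ_succ :
    rminExt x u z (m + 1) (a + 1) c A l K =
      letterSum x u (fun A l K => rminExt x u z m (a + 1) c A l K) c A l K +
        u * zeroWt z a * rminExt x u z m a c A 0 K := rfl

end Equations

theorem zeroExt_delete (u x z : R) {p : ℕ} (hp : 1 ≤ p) (m : ℕ) :
    ∀ {A l : ℕ} {K : Set ℕ}, p ≤ A + 1 → p ∉ K →
      x * zeroExt u x z m (A + 1) (skip p l) K =
        zeroExt u x z m (A + 1) (skip p l) (insert p K) +
          (x - 1) * zeroExt u x z m A l (skip p ⁻¹' K) := by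
  induction m with
  | zero => intros; simp [zeroExt]
  | succ m ih =>
    intro A l K hA hK
    simp only [zeroExt]
    refine letterSum_delete hA hK rfl fun v => ?_
    have h0 : skip p v = 0 ↔ v = 0 := by rw [← (skip_injective p).eq_iff (a := v), skip_zero hp]
    rw [if_congr h0 rfl rfl, ← preimage_insert_skip]
    have := ih (A := ascStep A l v) (l := v) (K := insert (skip p v) K)
      (by unfold ascStep; omega) (by simp [hK, (skip_ne p v).symm])
    linear_combination (if v = 0 then z else 1) * this

theorem rminExt_delete (x u z : R) {p : ℕ} (hp : 1 ≤ p) (m : ℕ) :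
    ∀ {a c A l : ℕ} {K : Set ℕ}, p ≤ A + 1 → p ∉ K →
      u * rminExt x u z m a c (A + 1) (skip p l) K =
        rminExt x u z m a c (A + 1) (skip p l) (insert p K) +
          (u - 1) * rminExt x u z m a (unskip p c) A l (skip p ⁻¹' K) := by
  induction m with
  | zero => intros; simp only [rminExt]; ring
  | succ m ih =>
    intro a c A l K hA hK
    have ih' := fun a c v => ih (a := a) (c := c) (A := ascStep A l v) (l := v)
      (K := insert (skip p v) K) (by unfold ascStep; omega) (by simp [hK, (skip_ne p v).symm])
    cases a with
    | zero =>
      simp only [rminExt]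
      refine letterSum_delete hA hK rfl fun v => ?_
      rw [← preimage_insert_skip]
      have h1 := ih' 0 (skip p v + 1) v
      rw [unskip_skip_succ] at h1
      linear_combination ih' 0 c v + (z - 1) * h1
    | succ a =>
      simp only [rminExt]
      have h0 := ih (a := a) (c := c) (l := 0) hA hK
      rw [skip_zero hp] at h0
      have h1 := letterSum_delete (a := x) (b := u) (f := rminExt x u z m (a + 1) c)
        (f' := rminExt x u z m (a + 1) c) (g := rminExt x u z m (a + 1) (unskip p c))
        (c := c) (l := l) hA hK rfl fun v => by rw [← preimage_insert_skip]; exact ih' (a + 1) c v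
      linear_combination h1 + u * zeroWt z a * h0

theorem rminExt_avoid (x u z : R) {p : ℕ} (hp : 1 ≤ p) (m : ℕ) :
    ∀ {a c A l : ℕ} {K : Set ℕ}, p ≤ A + 1 → p < c →
      rminExt x u z m a c (A + 1) (skip p l) K =
        rminExt x u z m a (c - 1) A l (skip p ⁻¹' K) := by
  induction m with
  | zero => intros; simp [rminExt]
  | succ m ih =>
    intro a c A l K hA hc
    have ih' := fun a v {c} (hc : p < c) => ih (a := a) (A := ascStep A l v) (l := v)
      (K := insert (skip p v) K) (by unfold ascStep; omega) hc
    cases a with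
    | zero =>
      simp only [rminExt]
      refine letterSum_avoid hA hc fun v hv => ?_
      have h1 := ih' 0 v (c := skip p v + 1) (by unfold skip; split_ifs <;> omega)
      have h2 : skip p v + 1 - 1 = v + 1 := by unfold skip; split_ifs <;> omega
      rw [ih' 0 v hc, h1, h2, preimage_insert_skip]
    | succ a =>
      simp only [rminExt]
      have h0 := ih (a := a) (l := 0) (K := K) hA hc
      rw [skip_zero hp] at h0
      have h1 := letterSum_avoid (a := x) (b := u) (f := rminExt x u z m (a + 1) c)
        (g := rminExt x u z m (a + 1) (c - 1))
        (c := c) (l := l) (K := K) hA hc fun v _ => by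
          rw [← preimage_insert_skip]; exact ih' (a + 1) v hc
      rw [h0, h1]

/-- Properties of the number of ascents `A`, the last letter `l` and the set of letters `K` of a
nonempty ascent sequence. -/
structure IsAscState (A l : ℕ) (K : Set ℕ) : Prop where
  zero_mem : 0 ∈ K
  last_mem : l ∈ K
  le : ∀ v ∈ K, v ≤ A
  one_mem : 1 ∈ K ∨ A = 0

theorem IsAscState.step {A l : ℕ} {K : Set ℕ} (h : IsAscState A l K) {v : ℕ} (hv : v ≤ A + 1) :
    IsAscState (ascStep A l v) v (insert v K) := by
  have hl := h.le l h.last_mem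
  refine ⟨.inr h.zero_mem, .inl rfl, ?_, ?_⟩
  · rintro w (rfl | hw)
    · unfold ascStep; split_ifs <;> omega
    · have := h.le w hw; unfold ascStep; omega
  · rcases h.one_mem with h1 | h1
    · exact .inl (.inr h1)
    · rcases Nat.eq_zero_or_pos v with rfl | h2
      · right; simp [ascStep, h1]
      · left; left; omega

theorem IsAscState.step_zero {A l : ℕ} {K : Set ℕ} (h : IsAscState A l K) : IsAscState A 0 K :=
  ⟨h.zero_mem, h.zero_mem, h.le, h.one_mem⟩

theorem isAscState_init : IsAscState 0 0 {0} := ⟨rfl, rfl, by simp, .inr rfl⟩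

theorem IsAscState.eq_singleton {l : ℕ} {K : Set ℕ} (h : IsAscState 0 l K) : l = 0 ∧ K = {0} := by
  refine ⟨Nat.le_zero.1 (h.le l h.last_mem), Set.Subset.antisymm (fun v hv => ?_) ?_⟩
  · exact Nat.le_zero.1 (h.le v hv)
  · simpa using h.zero_mem

theorem rminExt_eq_of_ncard [IsDomain R] (x u z : R) (hu : u ≠ 0) (m a : ℕ) (k : ℕ) :
    ∀ {A : ℕ} {K K' : Set ℕ}, 0 ∈ K → 0 ∈ K' → K ⊆ Set.Iic A → K' ⊆ Set.Iic A →
      K.ncard + k = A + 1 → K'.ncard + k = A + 1 →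
      rminExt x u z m a 1 A 0 K = rminExt x u z m a 1 A 0 K' := by
  induction k with
  | zero =>
    intro A K K' _ _ hK hK' hc hc'
    have hA : (Set.Iic A).ncard = A + 1 := by simp [Set.ncard_eq_toFinset_card']
    rw [Set.eq_of_subset_of_ncard_le hK (by omega) (Set.finite_Iic A),
      Set.eq_of_subset_of_ncard_le hK' (by omega) (Set.finite_Iic A)]
  | succ k ih =>
    have key : ∀ {A : ℕ} {K : Set ℕ}, 0 ∈ K → K ⊆ Set.Iic A → K.ncard + (k + 1) = A + 1 →
        ∃ B p, A = B + 1 ∧ 1 ≤ p ∧ p ≤ A ∧ p ∉ K ∧ (insert p K).ncard + k = A + 1 ∧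
          skip p ⁻¹' K ⊆ Set.Iic B ∧ (skip p ⁻¹' K).ncard + k = B + 1 ∧
          u * rminExt x u z m a 1 A 0 K = rminExt x u z m a 1 A 0 (insert p K) +
            (u - 1) * rminExt x u z m a 1 B 0 (skip p ⁻¹' K) := by
      intro A K h0 hK hc
      have hfin : K.Finite := (Set.finite_Iic A).subset hK
      obtain ⟨p, hpA, hpK⟩ : ∃ p ≤ A, p ∉ K := by
        by_contra! h
        have := Set.ncard_le_ncard (s := Set.Iic A) (t := K) h hfin
        have hA : (Set.Iic A).ncard = A + 1 := by simp [Set.ncard_eq_toFinset_card']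
        omega
      have hp : 1 ≤ p := Nat.one_le_iff_ne_zero.2 fun h => hpK (h ▸ h0)
      obtain ⟨B, rfl⟩ : ∃ B, A = B + 1 := ⟨A - 1, by omega⟩
      refine ⟨B, p, rfl, hp, hpA, hpK, ?_, ?_, ?_, ?_⟩
      · rw [Set.ncard_insert_of_notMem hpK hfin]; omega
      · intro v hv
        have := hK hv
        simp only [Set.mem_Iic] at this ⊢
        unfold skip at this; split_ifs at this <;> omega
      · rw [Set.ncard_preimage_of_injective_subset_range (skip_injective p)]
        · omega
        · intro v hv
          have : v ≠ p := fun h => hpK (h ▸ hv)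
          refine ⟨unskip p v, ?_⟩
          unfold skip unskip; split_ifs <;> omega
      · have := rminExt_delete x u z hp m (a := a) (c := 1) (A := B) (l := 0) hpA hpK
        rwa [skip_zero hp, show unskip p 1 = 1 by simp [unskip, hp]] at this
    intro A K K' h0 h0' hK hK' hc hc'
    obtain ⟨B, p, hB, hp, hpA, -, h1, h2, h3, h4⟩ := key h0 hK hc
    obtain ⟨B', p', hB', hp', hpA', -, h1', h2', h3', h4'⟩ := key h0' hK' hc'
    obtain rfl : B = B' := by omega
    refine mul_left_cancel₀ hu ?_
    rw [h4, h4', ih (.inr h0) (.inr h0') (Set.insert_subset hpA hK) (Set.insert_subset hpA' hK')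
      h1 h1', ih _ _ h2 h2' h3 h3']
    · simpa [skip_zero hp] using h0
    · simpa [skip_zero hp'] using h0'

theorem rminExt_two_last (x u z : R) (m a A : ℕ) (K : Set ℕ) :
    rminExt x u z m a 2 A 1 K = rminExt x u z m a 2 A 0 K := by
  have key : ∀ f, letterSum x u f 2 A 1 K = letterSum x u f 2 A 0 K := by
    intro f
    refine sum_congr rfl fun v hv => ?_
    rw [mem_Ico] at hv
    rw [letterWt_congr x u (l := 1) (l' := 0) (v' := v) (K' := K) (by omega) Iff.rfl,
      ascStep, ascStep, if_pos (by omega), if_pos (by omega)]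
  cases m with
  | zero => rfl
  | succ m => cases a <;> simp only [rminExt, key]

open Classical in
theorem rminExt_two_shift [IsDomain R] (x u z : R) (hu : u ≠ 0) (m a : ℕ) {A : ℕ} {K : Set ℕ}
    (h : IsAscState A 0 K) :
    letterWt x u 0 1 K * rminExt x u z m a 2 (A + 1) 1 (insert 1 K) =
      x * (rminExt x u z m a 1 A 0 K +
        (u - 1) * if 1 ∈ K then rminExt x u z m a 2 A 0 K else 0) := by
  have havoid : ∀ {A K}, rminExt x u z m a 2 (A + 1) 0 K =
      rminExt x u z m a 1 A 0 (skip 1 ⁻¹' K) := by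
    intro A K
    have := rminExt_avoid x u z le_rfl m (a := a) (c := 2) (A := A) (l := 0) (K := K)
      (by omega) (by omega)
    rwa [skip_zero le_rfl] at this
  have hpre : skip 1 ⁻¹' insert 1 K = skip 1 ⁻¹' K := by ext v; simp [skip_ne]
  rw [rminExt_two_last, havoid, hpre]
  by_cases h1 : 1 ∈ K
  · have hA := h.le 1 h1
    obtain ⟨B, rfl⟩ : ∃ B, A = B + 1 := ⟨A - 1, by omega⟩
    have hdel := rminExt_delete x u z le_rfl m (a := a) (c := 1) (A := B) (l := 0)
      (K := K \ {1}) (by omega) (by simp)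
    have hpre' : skip 1 ⁻¹' (K \ {1}) = skip 1 ⁻¹' K := by ext v; simp [skip_ne]
    rw [skip_zero le_rfl, show unskip 1 1 = 1 by simp [unskip], Set.insert_sdiff_singleton,
      Set.insert_eq_of_mem h1, hpre', ← havoid] at hdel
    have hfin : K.Finite := (Set.finite_Iic (B + 1)).subset h.le
    have hcard : (skip 1 ⁻¹' K).ncard = (K \ {1}).ncard := by
      rw [← hpre', Set.ncard_preimage_of_injective_subset_range (skip_injective 1)]
      intro v hv
      refine ⟨unskip 1 v, ?_⟩
      have : v ≠ 1 := hv.2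
      unfold skip unskip; split_ifs <;> omega
    have hlt : (K \ {1}).ncard ≤ B + 1 := by
      have := Set.ncard_le_ncard (s := K) (t := Set.Iic (B + 1)) h.le (Set.finite_Iic _)
      have hB : (Set.Iic (B + 1)).ncard = B + 2 := by simp [Set.ncard_eq_toFinset_card']
      have := Set.ncard_sdiff_singleton_lt_of_mem h1 hfin
      omega
    have hsymm : rminExt x u z m a 1 (B + 1) 0 (skip 1 ⁻¹' K) =
        rminExt x u z m a 1 (B + 1) 0 (K \ {1}) := by
      refine rminExt_eq_of_ncard x u z hu m a (B + 2 - (K \ {1}).ncard) ?_ ?_ ?_ ?_ ?_ ?_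
      · simpa [skip_zero] using h.zero_mem
      · simpa using h.zero_mem
      · intro v hv
        have := h.le _ hv
        simp only [Set.mem_Iic]
        unfold skip at this; split_ifs at this <;> omega
      · exact fun v hv => h.le v hv.1
      · omega
      · omega
    rw [if_pos h1, hsymm]
    have hw : letterWt x u 0 1 K = x * u := by simp [letterWt, h1]
    rw [hw]
    linear_combination x * hdel
  · have hA := h.one_mem.resolve_left h1
    subst hA
    obtain rfl := h.eq_singleton.2
    have hp : skip 1 ⁻¹' ({0} : Set ℕ) = {0} := by
      ext v
      simp only [Set.mem_preimage, Set.mem_singleton_iff]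
      rw [← (skip_injective 1).eq_iff (a := v) (b := 0), skip_zero le_rfl]
    rw [hp, if_neg h1]
    have hw : letterWt x u 0 1 ({0} : Set ℕ) = x := by simp [letterWt]
    rw [hw]
    ring

/-- Sum over all ways to append at most `m` letters, exactly `j` of them zeros, to an ascent
sequence, where the weight `φ` takes care of the remaining letters. -/
noncomputable def prefixSum (x u : R) (φ : ℕ → ℕ → ℕ → Set ℕ → R) :
    ℕ → ℕ → ℕ → ℕ → Set ℕ → R
  | 0, j, A, l, K => if j = 0 then φ 0 A l K else 0
  | m + 1, 0, A, l, K =>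
    φ (m + 1) A l K + letterSum x u (fun A l K => prefixSum x u φ m 0 A l K) 1 A l K
  | m + 1, j + 1, A, l, K =>
    letterSum x u (fun A l K => prefixSum x u φ m (j + 1) A l K) 1 A l K +
      u * prefixSum x u φ m j A 0 K

section Equations

variable (x u : R) (φ : ℕ → ℕ → ℕ → Set ℕ → R) (m j A l : ℕ) (K : Set ℕ)

theorem prefixSum_succ_zero :
    prefixSum x u φ (m + 1) 0 A l K =
      φ (m + 1) A l K + letterSum x u (fun A l K => prefixSum x u φ m 0 A l K) 1 A l K := rfl

theorem prefixSum_succ_succ :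
    prefixSum x u φ (m + 1) (j + 1) A l K =
      letterSum x u (fun A l K => prefixSum x u φ m (j + 1) A l K) 1 A l K +
        u * prefixSum x u φ m j A 0 K := rfl

end Equations

theorem prefixSum_congr (x u : R) {φ ψ : ℕ → ℕ → ℕ → Set ℕ → R}
    (h : ∀ m A l K, IsAscState A l K → φ m A l K = ψ m A l K) (m : ℕ) :
    ∀ {j A l : ℕ} {K : Set ℕ}, IsAscState A l K →
      prefixSum x u φ m j A l K = prefixSum x u ψ m j A l K := by
  induction m with
  | zero => intro j A l K hK; simp only [prefixSum, h _ _ _ _ hK]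
  | succ m ih =>
    intro j A l K hK
    cases j with
    | zero =>
      simp only [prefixSum, h _ _ _ _ hK]
      rw [letterSum_congr fun v _ hv => ih (hK.step hv)]
    | succ j =>
      simp only [prefixSum, ih hK.step_zero]
      rw [letterSum_congr fun v _ hv => ih (hK.step hv)]

theorem prefixSum_add (x u : R) (φ ψ : ℕ → ℕ → ℕ → Set ℕ → R) (m : ℕ) :
    ∀ (j A l : ℕ) (K : Set ℕ),
      prefixSum x u (fun m A l K => φ m A l K + ψ m A l K) m j A l K =
        prefixSum x u φ m j A l K + prefixSum x u ψ m j A l K := by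
  induction m with
  | zero => intro j A l K; simp only [prefixSum]; split_ifs <;> ring
  | succ m ih => intro j A l K; cases j <;> simp only [prefixSum, ih, letterSum_add] <;> ring

theorem prefixSum_mul (x u r : R) (φ : ℕ → ℕ → ℕ → Set ℕ → R) (m : ℕ) :
    ∀ (j A l : ℕ) (K : Set ℕ),
      prefixSum x u (fun m A l K => r * φ m A l K) m j A l K =
        r * prefixSum x u φ m j A l K := by
  induction m with
  | zero => intro j A l K; simp only [prefixSum]; split_ifs <;> ring
  | succ m ih => intro j A l K; cases j <;> simp only [prefixSum, ih, letterSum_mul] <;> ring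

theorem prefixSum_eq_zero (x u : R) (φ : ℕ → ℕ → ℕ → Set ℕ → R) (m : ℕ) :
    ∀ {j A l : ℕ} {K : Set ℕ}, (∀ i A l K, i + j ≤ m → φ i A l K = 0) →
      prefixSum x u φ m j A l K = 0 := by
  induction m with
  | zero =>
    intro j A l K h
    simp only [prefixSum]
    split_ifs with hj
    · exact h _ _ _ _ (by omega)
    · rfl
  | succ m ih =>
    intro j A l K h
    cases j with
    | zero =>
      simp only [prefixSum]
      rw [h _ _ _ _ (by omega), letterSum_congr (g := fun _ _ _ => 0), letterSum_zero, add_zero]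
      exact fun v _ _ => ih fun i A l K hi => h i A l K (by omega)
    | succ j =>
      simp only [prefixSum]
      rw [ih fun i A l K hi => h i A l K (by omega), letterSum_congr (g := fun _ _ _ => 0),
        letterSum_zero, mul_zero, add_zero]
      exact fun v _ _ => ih fun i A l K hi => h i A l K (by omega)

/-- The weight of a final letter `1` followed by `m` letters other than `1`, exactly `a` of them
zeros. -/
noncomputable def lastOneWt (x u z : R) (a m A l : ℕ) (K : Set ℕ) : R :=
  letterWt x u l 1 K * rminExt x u z m a 2 (ascStep A l 1) 1 (insert 1 K)

open Classical in
/-- The weight of `m` letters other than `1`, exactly `a` of them zeros, that follow a zero and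
earlier letters among which `1` occurs. -/
noncomputable def cutWt (x u z : R) (a m A : ℕ) (K : Set ℕ) : R :=
  if 1 ∈ K then rminExt x u z m a 2 A 0 K else 0

/-- Sum of `prefixSum` over all ways to distribute `j` between the first letters and the rest. -/
noncomputable def distribSum (x u : R) (Φ : ℕ → ℕ → ℕ → ℕ → Set ℕ → R) (m j A l : ℕ)
    (K : Set ℕ) : R :=
  ∑ p ∈ antidiagonal j, prefixSum x u (Φ p.1) m p.2 A l K

section DistribSum

variable (x u : R) (Φ : ℕ → ℕ → ℕ → ℕ → Set ℕ → R) (m j A l : ℕ) (K : Set ℕ)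

theorem distribSum_zero : distribSum x u Φ 0 j A l K = Φ j 0 A l K := by
  unfold distribSum
  cases j with
  | zero => simp [prefixSum]
  | succ j => rw [Finset.Nat.sum_antidiagonal_succ']; simp [prefixSum]

theorem distribSum_succ_zero :
    distribSum x u Φ (m + 1) 0 A l K =
      Φ 0 (m + 1) A l K + letterSum x u (fun A l K => distribSum x u Φ m 0 A l K) 1 A l K := by
  simp [distribSum, prefixSum]

theorem distribSum_succ_succ :
    distribSum x u Φ (m + 1) (j + 1) A l K =
      Φ (j + 1) (m + 1) A l K +
        letterSum x u (fun A l K => distribSum x u Φ m (j + 1) A l K) 1 A l K +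
          u * distribSum x u Φ m j A 0 K := by
  simp only [distribSum, Finset.Nat.sum_antidiagonal_succ', prefixSum, letterSum_add,
    letterSum_sum, sum_add_distrib, mul_sum]
  ring

end DistribSum

theorem letterSum_one_mem (x u : R) (f : ℕ → ℕ → Set ℕ → R) (A l : ℕ) (K : Set ℕ)
    [∀ K : Set ℕ, Decidable (1 ∈ K)] :
    letterSum x u (fun A l K => if 1 ∈ K then f A l K else 0) 1 A l K =
      letterWt x u l 1 K * f (ascStep A l 1) 1 (insert 1 K) +
        if 1 ∈ K then letterSum x u f 2 A l K else 0 := by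
  rw [letterSum_one, if_pos (Set.mem_insert _ _)]
  congr 1
  split_ifs with h
  · exact letterSum_congr fun v _ _ => if_pos (.inr h)
  · refine (letterSum_congr fun v hv _ => if_neg ?_).trans (letterSum_zero ..)
    simp only [Set.mem_insert_iff, not_or]
    exact ⟨by omega, h⟩

theorem zeroWt_succ (z : R) (a : ℕ) : zeroWt z (a + 1) = 1 := if_neg (by omega)

open Classical in
/-- A word with more than `a` zeros after its last `1` is cut at the last zero but `a`. -/
theorem distribSum_cut (x u z : R) (a m : ℕ) :
    ∀ (j A l : ℕ) (K : Set ℕ),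
      distribSum x u (fun i => lastOneWt x u z (a + 1 + i)) m j A l K +
          (if 1 ∈ K then rminExt x u z (m + 1) (a + 1 + j) 2 A l K else 0) =
        u * zeroWt z a * prefixSum x u (fun m A _ K => cutWt x u z a m A K) m j A l K := by
  have hsucc : ∀ b, a + 1 + b = a + b + 1 := fun b => by omega
  induction m with
  | zero =>
    intro j A l K
    simp only [distribSum_zero, hsucc, lastOneWt, rminExt, prefixSum, cutWt,
      Nat.add_eq_zero_iff]
    rcases Nat.eq_zero_or_pos j with rfl | hj
    · by_cases ha : a = 0 <;> simp [ha, letterSum_zero]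
    · simp [hj.ne', letterSum_zero]
  | succ m ih =>
    intro j A l K
    have ih' : ∀ j, (fun A l K => distribSum x u (fun i => lastOneWt x u z (a + 1 + i)) m j A l K)
        = fun A l K => u * zeroWt z a *
          prefixSum x u (fun m A _ K => cutWt x u z a m A K) m j A l K + (-1) *
          (if 1 ∈ K then rminExt x u z (m + 1) (a + 1 + j) 2 A l K else 0) := by
      intro j; funext A l K; linear_combination ih j A l K
    cases j with
    | zero =>
      rw [distribSum_succ_zero, ih', letterSum_add, letterSum_mul, letterSum_mul,
        letterSum_one_mem]
      simp only [prefixSum, lastOneWt, add_zero, cutWt, rminExt_succ_succ x u z (m + 1) a 2]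
      split_ifs <;> ring
    | succ j =>
      have ih0 := ih j A 0 K
      rw [distribSum_succ_succ, ih', letterSum_add, letterSum_mul, letterSum_mul,
        letterSum_one_mem]
      rw [← add_assoc (a + 1) j 1, prefixSum_succ_succ]
      have h1 : zeroWt z (a + 1 + j) = 1 := by rw [hsucc, zeroWt_succ]
      simp only [lastOneWt, ← add_assoc, rminExt_succ_succ x u z (m + 1) (a + 1 + j) 2, h1]
      split_ifs at ih0 ⊢ <;> linear_combination u * ih0

theorem rminExt_one_zero (x u z : R) (m : ℕ) :
    ∀ (A l : ℕ) (K : Set ℕ),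
      rminExt x u z (m + 1) 0 1 A l K =
        rminExt x u z (m + 1) 0 2 A l K + z * prefixSum x u (lastOneWt x u z 0) m 0 A l K := by
  induction m with
  | zero =>
    intro A l K
    rw [rminExt_succ_zero, letterSum_one, rminExt_succ_zero]
    simp only [rminExt, prefixSum, lastOneWt, if_true]
    ring
  | succ m ih =>
    intro A l K
    rw [rminExt_succ_zero, letterSum_one, rminExt_succ_zero x u z (m + 1) 2]
    have h : letterSum x u (fun A l K => rminExt x u z (m + 1) 0 1 A l K +
        (z - 1) * rminExt x u z (m + 1) 0 (l + 1) A l K) 2 A l K =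
        letterSum x u (fun A l K => (rminExt x u z (m + 1) 0 2 A l K +
          (z - 1) * rminExt x u z (m + 1) 0 (l + 1) A l K) +
            z * prefixSum x u (lastOneWt x u z 0) m 0 A l K) 2 A l K :=
      letterSum_congr fun v _ _ => by rw [ih]; ring
    rw [h, letterSum_add, letterSum_mul, ih, prefixSum_succ_zero, letterSum_one, lastOneWt]
    ring

/-- Words are classified by their last `1`. -/
theorem zeroWt_mul_rminExt_one (x u z : R) (m : ℕ) :
    ∀ (b A l : ℕ) (K : Set ℕ),
      zeroWt z b * rminExt x u z (m + 1) b 1 A l K =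
        zeroWt z b * rminExt x u z (m + 1) b 2 A l K +
          distribSum x u (fun i m A l K => zeroWt z i ^ 2 * lastOneWt x u z i m A l K)
            m b A l K := by
  have h0 : ∀ m A l K, zeroWt z 0 * rminExt x u z (m + 1) 0 1 A l K =
        zeroWt z 0 * rminExt x u z (m + 1) 0 2 A l K +
          distribSum x u (fun i m A l K => zeroWt z i ^ 2 * lastOneWt x u z i m A l K)
            m 0 A l K := by
    intro m A l K
    rw [rminExt_one_zero]
    simp only [distribSum, Finset.Nat.antidiagonal_zero, sum_singleton, prefixSum_mul]
    simp only [zeroWt, if_true]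
    ring
  induction m with
  | zero =>
    intro b A l K
    cases b with
    | zero => exact h0 ..
    | succ b =>
      rw [distribSum_zero]
      simp [rminExt, lastOneWt, letterSum_zero]
  | succ m ih =>
    intro b A l K
    cases b with
    | zero => exact h0 ..
    | succ b =>
      have ih' := ih (b + 1)
      simp only [zeroWt_succ, one_mul] at ih' ⊢
      have h := ih b A 0 K
      rw [distribSum_succ_succ, rminExt_succ_succ, rminExt_succ_succ x u z (m + 1) b 2,
        letterSum_one, letterSum_one, letterSum_congr (c := 2) (g := fun A l K =>
          rminExt x u z (m + 1) (b + 1) 2 A l K + distribSum x u (fun i m A l K =>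
            zeroWt z i ^ 2 * lastOneWt x u z i m A l K) m (b + 1) A l K) fun v _ _ => ih' _ _ _,
        letterSum_add, ih', zeroWt_succ, lastOneWt]
      linear_combination u * h

section LastZero

variable (x u : R) (χ : ℕ → ℕ → Set ℕ → R)

theorem prefixSum_last_zero (m : ℕ) : ∀ (A l : ℕ) (K : Set ℕ),
    prefixSum x u (fun m A l K => if l = 0 then χ m A K else 0) m 0 A l K =
      if l = 0 then χ m A K else 0 := by
  induction m with
  | zero => intros; simp [prefixSum]
  | succ m ih =>
    intro A l K
    rw [prefixSum_succ_zero, letterSum_congr (g := fun _ _ _ => 0), letterSum_zero, add_zero]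
    intro v hv _
    rw [ih, if_neg (by omega)]

theorem prefixSum_last_zero_succ (m : ℕ) : ∀ (j A l : ℕ) (K : Set ℕ),
    prefixSum x u (fun m A l K => if l = 0 then χ m A K else 0) (m + 1) (j + 1) A l K =
      u * prefixSum x u (fun m A _ K => χ m A K) m j A l K := by
  induction m with
  | zero => intro j A l K; simp [prefixSum, letterSum_zero]
  | succ m ih =>
    intro j A l K
    rw [prefixSum_succ_succ, letterSum_congr (g := fun A l K =>
      u * prefixSum x u (fun m A _ K => χ m A K) m j A l K) fun v _ _ => ih _ _ _ _, letterSum_mul]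
    cases j with
    | zero => rw [prefixSum_last_zero, if_pos rfl, prefixSum_succ_zero]; ring
    | succ j => rw [ih, prefixSum_succ_succ]; ring

end LastZero

/-- Words are cut at their last zero but `a`. -/
theorem rminExt_cut (x u z : R) (a m : ℕ) : ∀ (j A l : ℕ) (K : Set ℕ),
    rminExt x u z (m + 1) (a + j + 1) 1 A l K =
      u * zeroWt z a * prefixSum x u (fun m A _ K => rminExt x u z m a 1 A 0 K) m j A l K := by
  induction m with
  | zero =>
    intro j A l K
    rcases Nat.eq_zero_or_pos j with rfl | hj
    · by_cases ha : a = 0 <;> simp [ha, rminExt, prefixSum, letterSum_zero]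
    · simp [hj.ne', rminExt, prefixSum, letterSum_zero]
  | succ m ih =>
    intro j A l K
    rw [rminExt_succ_succ, letterSum_congr (g := fun A l K => u * zeroWt z a *
      prefixSum x u (fun m A _ K => rminExt x u z m a 1 A 0 K) m j A l K) fun v _ _ => ih _ _ _ _,
      letterSum_mul]
    cases j with
    | zero => rw [prefixSum_succ_zero, add_zero]; ring
    | succ j => rw [← add_assoc, ih, zeroWt_succ, prefixSum_succ_succ]; ring

theorem zeroWt_mul_rminExt_one_eq_prefixSum (x u z : R) (a m j A : ℕ) (K : Set ℕ) :
    zeroWt z (a + j) * rminExt x u z m (a + j) 1 A 0 K =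
      zeroWt z a * prefixSum x u
        (fun m A l K => if l = 0 then rminExt x u z m a 1 A 0 K else 0) m j A 0 K := by
  cases j with
  | zero => rw [prefixSum_last_zero x u fun m A K => rminExt x u z m a 1 A 0 K]; simp
  | succ j =>
    cases m with
    | zero => simp [rminExt, prefixSum]
    | succ m =>
      rw [prefixSum_last_zero_succ x u fun m A K => rminExt x u z m a 1 A 0 K, ← add_assoc,
        rminExt_cut, zeroWt_succ]
      ring

theorem rminExt_eq_zero (x u z : R) (m : ℕ) : ∀ {a : ℕ} (c A l : ℕ) (K : Set ℕ), m < a →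
    rminExt x u z m a c A l K = 0 := by
  induction m with
  | zero => intro a c A l K h; exact if_neg (by omega)
  | succ m ih =>
    intro a c A l K h
    obtain ⟨a, rfl⟩ : ∃ b, a = b + 1 := ⟨a - 1, by omega⟩
    rw [rminExt_succ_succ, ih _ _ _ _ (by omega), letterSum_congr (g := fun _ _ _ => 0)
      fun v _ _ => ih _ _ _ _ (by omega), letterSum_zero, mul_zero, add_zero]

theorem zeroWt_mul_rminExt_self (x u z : R) (m : ℕ) : ∀ (c A l : ℕ) (K : Set ℕ),
    zeroWt z m * rminExt x u z m m c A l K = z * u ^ m := by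
  induction m with
  | zero => intros; simp [zeroWt, rminExt]
  | succ m ih =>
    intro c A l K
    rw [rminExt_succ_succ, letterSum_congr (g := fun _ _ _ => 0)
      fun v _ _ => rminExt_eq_zero x u z m _ _ _ _ (by omega), letterSum_zero, zeroWt_succ]
    linear_combination u * ih c A 0 K

theorem rminExt_two_eq_zero (x u z : R) (m : ℕ) : ∀ {a : ℕ} (l : ℕ) (K : Set ℕ), a < m →
    rminExt x u z m a 2 0 l K = 0 := by
  induction m with
  | zero => intro a l K h; omega
  | succ m ih =>
    intro a l K h
    cases a with
    | zero => simp [rminExt_succ_zero, letterSum]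
    | succ a => rw [rminExt_succ_succ, ih _ _ (by omega)]; simp [letterSum]

theorem lastOneWt_eq [IsDomain R] (x u z : R) (hu : u ≠ 0) (a m : ℕ) {A l : ℕ} {K : Set ℕ}
    (h : IsAscState A l K) :
    lastOneWt x u z a m A l K =
      u * cutWt x u z a m A K +
        (x * (if l = 0 then rminExt x u z m a 1 A 0 K else 0) +
          (x * u - u - x) * (if l = 0 then cutWt x u z a m A K else 0)) := by
  unfold lastOneWt cutWt
  by_cases hl : l = 0
  · subst hl
    rw [show ascStep A 0 1 = A + 1 from rfl, rminExt_two_shift x u z hu m a h]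
    simp only [if_true]
    ring
  · have h1 : 1 ∈ K := by
      refine h.one_mem.resolve_right fun hA => hl ?_
      subst hA
      exact h.eq_singleton.1
    have hw : letterWt x u l 1 K = u := by
      rw [letterWt, if_neg (by omega), if_pos h1, one_mul]
    rw [hw, show ascStep A l 1 = A by unfold ascStep; split_ifs <;> omega,
      Set.insert_eq_of_mem h1, rminExt_two_last, if_pos h1, if_neg hl, if_neg hl]
    ring

/-- Sum over the words with `j` zeros before and more than `a` zeros after the last `1`. -/
noncomputable def lastOneTail (x u z : R) (a m j : ℕ) : R :=
  distribSum x u (fun i => lastOneWt x u z (a + 1 + i)) m j 0 0 {0}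

theorem zeroWt_mul_prefixSum_cutWt (x u z : R) (a m j : ℕ) :
    u * zeroWt z a * prefixSum x u (fun m A _ K => cutWt x u z a m A K) m j 0 0 {0} =
      lastOneTail x u z a m j := by
  rw [lastOneTail, ← distribSum_cut, if_neg (by simp), add_zero]

theorem zeroWt_mul_prefixSum_lastOneWt [IsDomain R] (x u z : R) (hu : u ≠ 0) (a m j : ℕ) :
    zeroWt z a * prefixSum x u (lastOneWt x u z a) m j 0 0 {0} =
      lastOneTail x u z a m j + x * (zeroWt z (a + j) * rminExt x u z m (a + j) 1 0 0 {0}) +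
        (x * u - u - x) *
          if m = 0 ∨ j = 0 then 0 else lastOneTail x u z a (m - 1) (j - 1) := by
  have h0 : zeroWt z a * prefixSum x u
      (fun m A l K => if l = 0 then cutWt x u z a m A K else 0) m j 0 0 {0} =
        if m = 0 ∨ j = 0 then 0 else lastOneTail x u z a (m - 1) (j - 1) := by
    cases j with
    | zero => rw [prefixSum_last_zero x u fun m A K => cutWt x u z a m A K]; simp [cutWt]
    | succ j =>
      cases m with
      | zero => simp [prefixSum]
      | succ m =>
        rw [prefixSum_last_zero_succ x u fun m A K => cutWt x u z a m A K, if_neg (by omega),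
          Nat.add_sub_cancel, Nat.add_sub_cancel, ← zeroWt_mul_prefixSum_cutWt]
        ring
  rw [prefixSum_congr x u (fun m A l K h => lastOneWt_eq x u z hu a m h) m isAscState_init,
    prefixSum_add, prefixSum_add, prefixSum_mul, prefixSum_mul, prefixSum_mul, ← h0,
    ← zeroWt_mul_prefixSum_cutWt, zeroWt_mul_rminExt_one_eq_prefixSum]
  ring

/-- Sum over the ascent sequences of length `q + k + 2` with `q + 1` zeros, `a` of them after the
last `1`. -/
noncomputable def lastOneTotal (x u z : R) (k q a : ℕ) : R :=
  zeroWt z a ^ 2 * prefixSum x u (lastOneWt x u z a) (q + k) (q - a) 0 0 {0}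

/-- Sum over the ascent sequences of length `q + k + 1` with `q + 1` zeros. -/
noncomputable def rminTotal (x u z : R) (k q : ℕ) : R :=
  zeroWt z q * rminExt x u z (q + k) q 1 0 0 {0}

theorem rminTotal_zero (x u z : R) (q : ℕ) : rminTotal x u z 0 q = z * u ^ q :=
  zeroWt_mul_rminExt_self ..

theorem rminTotal_succ (x u z : R) (k q : ℕ) :
    rminTotal x u z (k + 1) q = ∑ a ∈ range (q + 1), lastOneTotal x u z k q a := by
  rw [rminTotal, ← add_assoc, zeroWt_mul_rminExt_one, rminExt_two_eq_zero _ _ _ _ _ _ (by omega),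
    mul_zero, zero_add, distribSum,
    Finset.Nat.sum_antidiagonal_eq_sum_range_succ_mk]
  simp only [prefixSum_mul, lastOneTotal]

theorem lastOneTail_succ (x u z : R) (k : ℕ) {q a : ℕ} (h : a ≤ q) :
    lastOneTail x u z a (q + k + 1) (q - a) =
      ∑ b ∈ Ico (a + 1) (q + 2), lastOneTotal x u z k (q + 1) b := by
  rw [lastOneTail, distribSum, Finset.Nat.sum_antidiagonal_eq_sum_range_succ_mk,
    sum_Ico_eq_sum_range, show q + 2 - (a + 1) = q - a + 1 by omega]
  refine sum_congr rfl fun i _ => ?_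
  rw [lastOneTotal, show a + 1 + i = a + i + 1 by omega, zeroWt_succ, one_pow, one_mul,
    show q + k + 1 = q + 1 + k by omega, show q + 1 - (a + i + 1) = q - a - i by omega]

theorem lastOneTail_eq_zero (x u z : R) {m j a : ℕ} (h : m ≤ j + a) :
    lastOneTail x u z a m j = 0 := by
  rw [lastOneTail, distribSum]
  refine sum_eq_zero fun p hp => prefixSum_eq_zero _ _ _ _ fun i A l K hi => ?_
  rw [HasAntidiagonal.mem_antidiagonal] at hp
  rw [lastOneWt, rminExt_eq_zero _ _ _ _ _ _ _ _ (by omega), mul_zero]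

theorem lastOneTotal_zero [IsDomain R] (x u z : R) (hu : u ≠ 0) {q a : ℕ} (h : a ≤ q) :
    lastOneTotal x u z 0 q a = zeroWt z a * (x * (z * u ^ q)) := by
  rw [lastOneTotal, pow_two, mul_assoc, zeroWt_mul_prefixSum_lastOneWt x u z hu,
    lastOneTail_eq_zero x u z (by omega), Nat.add_sub_cancel' h, add_zero, zeroWt_mul_rminExt_self]
  have h0 : (if q = 0 ∨ q - a = 0 then (0 : R) else
      lastOneTail x u z a (q - 1) (q - a - 1)) = 0 := by
    split_ifs
    · rfl
    · exact lastOneTail_eq_zero x u z (by omega)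
  rw [h0]
  ring

theorem lastOneTotal_succ [IsDomain R] (x u z : R) (hu : u ≠ 0) (k : ℕ) {q a : ℕ} (h : a ≤ q) :
    lastOneTotal x u z (k + 1) q a =
      zeroWt z a * (∑ b ∈ Ico (a + 1) (q + 2), lastOneTotal x u z k (q + 1) b +
        x * ∑ b ∈ range (q + 1), lastOneTotal x u z k q b +
        (x * u - u - x) * ∑ b ∈ Ico (a + 1) (q + 1), lastOneTotal x u z k q b) := by
  rw [lastOneTotal, pow_two, mul_assoc, zeroWt_mul_prefixSum_lastOneWt x u z hu,
    Nat.add_sub_cancel' h, ← rminTotal, rminTotal_succ, ← add_assoc q, lastOneTail_succ x u z k h]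
  congr 3
  by_cases h0 : q - a = 0
  · rw [if_pos (.inr h0), Ico_eq_empty (by omega), sum_empty]
  · obtain ⟨q, rfl⟩ : ∃ r, q = r + 1 := ⟨q - 1, by omega⟩
    rw [if_neg (by omega), ← lastOneTail_succ x u z k (by omega),
      show q + 1 + k + 1 - 1 = q + k + 1 by omega, show q + 1 - a - 1 = q - a by omega]

/-- Sum over the ascent sequences of length `q + k + 1` with at least `q + 1` zeros. -/
noncomputable def rminTail (x u z : R) : ℕ → ℕ → R
  | 0, q => rminTotal x u z 0 q
  | k + 1, q => rminTotal x u z (k + 1) q + rminTail x u z k (q + 1)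

/-- The weight of `m` letters with `a` zeros and no zero before the last `1`, after a nonempty word
without zeros. -/
noncomputable def zerosLastWt (x u z : R) (a m A l : ℕ) (K : Set ℕ) : R :=
  rminExt x u z m a 2 A l K +
    if m = 0 then 0 else prefixSum x u (lastOneWt x u z a) (m - 1) 0 A l K

theorem zerosLastWt_succ (x u z : R) (a m A l : ℕ) (K : Set ℕ) :
    zerosLastWt x u z (a + 1) (m + 1) A l K =
      letterSum x u (zerosLastWt x u z (a + 1) m) 1 A l K +
        u * zeroWt z a * rminExt x u z m a 2 A 0 K := by
  rw [zerosLastWt, rminExt_succ_succ, if_neg (by omega), Nat.add_sub_cancel]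
  have h : letterSum x u (zerosLastWt x u z (a + 1) m) 1 A l K =
      letterSum x u (fun A l K => rminExt x u z m (a + 1) 2 A l K +
        if m = 0 then 0 else prefixSum x u (lastOneWt x u z (a + 1)) (m - 1) 0 A l K) 1 A l K := rfl
  rw [h, letterSum_add, letterSum_one]
  cases m with
  | zero => simp only [if_true, letterSum_zero, prefixSum, lastOneWt]; ring
  | succ m =>
    simp only [Nat.add_sub_cancel, if_neg (Nat.succ_ne_zero m), prefixSum_succ_zero, lastOneWt]
    ring

theorem letterSum_succ_image (x u : R) (f : ℕ → ℕ → Set ℕ → R) (A l : ℕ) (K : Set ℕ) :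
    letterSum x u f 1 (A + 1) (l + 1) (insert 0 (Nat.succ '' K)) =
      letterSum x u (fun A l K => f (A + 1) (l + 1) (insert 0 (Nat.succ '' K))) 0 A l K := by
  rw [letterSum, letterSum, sum_Ico_eq_sum_range, ← range_eq_Ico]
  refine sum_congr rfl fun v _ => ?_
  rw [add_comm 1 v, letterWt_congr x u (l' := l) (v' := v) (K' := K) (by omega) (by simp),
    Set.insert_comm, Set.image_insert_eq]
  congr 2
  simp only [ascStep, Nat.add_lt_add_iff_right]
  omega

theorem zerosLastWt_eq_sum (x u z : R) (a N m : ℕ) :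
    ∀ {A l : ℕ} {K : Set ℕ}, 0 ∈ K → m < a + 1 + N →
      zerosLastWt x u z (a + 1) m (A + 1) (l + 1) (insert 0 (Nat.succ '' K)) =
        ∑ i ∈ range N, rminExt x u z m (a + 1 + i) 1 A l K := by
  induction m with
  | zero =>
    intro A l K h0 hN
    simp [zerosLastWt, rminExt]
  | succ m ih =>
    intro A l K h0 hN
    have hpre : skip 1 ⁻¹' insert 0 (Nat.succ '' K) = K := by
      ext v
      cases v with
      | zero => simpa [skip] using h0
      | succ v => simp [skip]
    have hz := rminExt_avoid x u z le_rfl m (a := a) (c := 2) (A := A) (l := 0)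
      (K := insert 0 (Nat.succ '' K)) (by omega) (by omega)
    rw [skip_zero le_rfl, hpre] at hz
    have hw : letterWt x u l 0 K = u := by
      rw [letterWt, if_neg (by omega), if_pos h0, one_mul]
    rw [zerosLastWt_succ, letterSum_succ_image, letterSum_congr (g := fun A l K =>
      ∑ i ∈ range N, rminExt x u z m (a + 1 + i) 1 A l K)
      fun v _ _ => ih (Set.mem_insert_of_mem _ h0) (by omega), letterSum_sum, hz]
    have h1 : ∀ i, letterSum x u (fun A l K => rminExt x u z m (a + 1 + i) 1 A l K) 0 A l K =
        u * zeroWt z (a + 1 + i) * rminExt x u z m (a + 1 + i) 1 A 0 K +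
          letterSum x u (fun A l K => rminExt x u z m (a + 1 + i) 1 A l K) 1 A l K := by
      intro i
      rw [letterSum, sum_eq_sum_Ico_succ_bot (by omega), hw, Set.insert_eq_of_mem h0,
        show a + 1 + i = a + i + 1 by omega, zeroWt_succ, mul_one]
      rfl
    have h2 : ∀ i, rminExt x u z (m + 1) (a + 1 + i) 1 A l K =
        letterSum x u (fun A l K => rminExt x u z m (a + 1 + i) 1 A l K) 1 A l K +
          u * zeroWt z (a + i) * rminExt x u z m (a + i) 1 A 0 K := by
      intro i
      rw [show a + 1 + i = a + i + 1 by omega]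
      rfl
    simp only [h1, h2, sum_add_distrib]
    have h3 := sum_range_succ (fun i => u * zeroWt z (a + i) * rminExt x u z m (a + i) 1 A 0 K) N
    rw [sum_range_succ', rminExt_eq_zero x u z m (a := a + N) _ _ _ _ (by omega)] at h3
    simp only [← add_assoc, add_right_comm a 1] at h3 ⊢
    linear_combination h3

theorem rminTail_eq_sum (x u z : R) (k : ℕ) : ∀ q : ℕ,
    rminTail x u z k (q + 1) =
      ∑ i ∈ range (k + 1), rminExt x u z (q + 1 + k) (q + 1 + i) 1 0 0 {0} := by
  induction k with
  | zero => intro q; simp [rminTail, rminTotal, zeroWt_succ]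
  | succ k ih =>
    intro q
    rw [rminTail, ih, sum_range_succ' _ (k + 1), rminTotal, zeroWt_succ, one_mul, add_zero,
      add_comm, add_left_inj]
    refine sum_congr rfl fun i _ => ?_
    rw [show q + 1 + (k + 1) = q + 1 + 1 + k by omega,
      show q + 1 + (i + 1) = q + 1 + 1 + i by omega]

theorem lastOneTotal_self (x u z : R) (k q : ℕ) :
    lastOneTotal x u z k (q + 1) (q + 1) = x * rminTail x u z k (q + 1) := by
  have h1 : prefixSum x u (lastOneWt x u z (q + 1)) (q + k + 1) 0 0 0 {0} =
      x * zerosLastWt x u z (q + 1) (q + k + 1) 1 1 {0, 1} := by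
    have hw : letterWt x u 0 1 {0} = x := by simp [letterWt]
    rw [prefixSum_succ_zero, letterSum_one, lastOneWt, hw, zerosLastWt, if_neg (by omega),
      Set.pair_comm, Nat.add_sub_cancel]
    simp [letterSum, ascStep]
    ring
  have h2 := zerosLastWt_eq_sum x u z q (k + 1) (q + k + 1) (A := 0) (l := 0) (K := {0}) rfl
    (by omega)
  rw [Set.image_singleton] at h2
  rw [lastOneTotal, zeroWt_succ, one_pow, one_mul, Nat.sub_self, rminTail_eq_sum,
    show q + 1 + k = q + k + 1 by omega, h1, h2]

theorem ascStep_of_le {l v : ℕ} (h : v ≤ l) (A : ℕ) : ascStep A l v = A := by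
  rw [ascStep, if_neg (by omega), add_zero]

theorem ascStep_of_lt {l v : ℕ} (h : l < v) (A : ℕ) : ascStep A l v = A + 1 := by
  rw [ascStep, if_pos h]

/-- Sum over the ascent sequences of length `q + k + 1` that start with `0, 1, …, q`. -/
noncomputable def stairExt (u x z : R) (k q : ℕ) : R :=
  z * u ^ q * zeroExt u x z k q q (Set.Iio (q + 1))

/-- Sum over the ascent sequences of length `q + k + 2` that start with `0, 1, …, q, a`, where
`a ≤ q`. -/
noncomputable def stairLetterExt (u x z : R) (k q a : ℕ) : R :=
  zeroWt z a * (z * u ^ q * x) * zeroExt u x z k q a (Set.Iio (q + 1))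

theorem stairExt_succ (u x z : R) (k q : ℕ) :
    stairExt u x z (k + 1) q =
      ∑ b ∈ range (q + 1), stairLetterExt u x z k q b + stairExt u x z k (q + 1) := by
  rw [stairExt, zeroExt, letterSum, ← range_eq_Ico, sum_range_succ, mul_add, mul_sum]
  congr 1
  · refine sum_congr rfl fun b hb => ?_
    rw [mem_range] at hb
    have h : b ∈ Set.Iio (q + 1) := hb
    rw [letterWt, if_neg (by omega), if_pos h, ascStep_of_le (by omega),
      Set.insert_eq_of_mem h, stairLetterExt, zeroWt]
    ring
  · rw [letterWt, if_pos (by omega), if_neg (by simp), ascStep_of_lt (by omega),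
      if_neg (by omega), stairExt, ← Order.Iio_succ_eq_insert]
    simp only [Nat.succ_eq_succ, Nat.succ_eq_add_one]
    ring

theorem stairLetterExt_zero (u x z : R) (q a : ℕ) :
    stairLetterExt u x z 0 q a = zeroWt z a * (x * (z * u ^ q)) := by
  rw [stairLetterExt, zeroExt]; ring

theorem stairLetterExt_succ (u x z : R) (k : ℕ) {q a : ℕ} (ha : a ≤ q) :
    stairLetterExt u x z (k + 1) q a =
      zeroWt z a * (∑ b ∈ Ico (a + 1) (q + 1), stairLetterExt u x z k (q + 1) b +
        x * stairExt u x z k (q + 1) + x * ∑ b ∈ range (q + 1), stairLetterExt u x z k q b +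
        (x * u - u - x) * ∑ b ∈ Ico (a + 1) (q + 1), stairLetterExt u x z k q b) := by
  have hK : insert (q + 1) (Set.Iio (q + 1)) = Set.Iio (q + 2) := by
    ext v; simp only [Set.mem_insert_iff, Set.mem_Iio]; omega
  have h1 : ∀ b ∈ range (a + 1), z * u ^ q * x * (letterWt u x a b (Set.Iio (q + 1)) *
      ((if b = 0 then z else 1) * zeroExt u x z k (ascStep q a b) b
        (insert b (Set.Iio (q + 1))))) = x * stairLetterExt u x z k q b := by
    intro b hb
    rw [mem_range] at hb
    have h : b ∈ Set.Iio (q + 1) := by simp only [Set.mem_Iio]; omega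
    rw [letterWt, if_neg (by omega), if_pos h, ascStep_of_le (by omega),
      Set.insert_eq_of_mem h, stairLetterExt, zeroWt]
    ring
  have h2 : ∀ b ∈ Ico (a + 1) (q + 1), z * u ^ q * x * (letterWt u x a b (Set.Iio (q + 1)) *
      ((if b = 0 then z else 1) * zeroExt u x z k (ascStep q a b) b
        (insert b (Set.Iio (q + 1))))) = stairLetterExt u x z k (q + 1) b +
          (x - 1) * u * stairLetterExt u x z k q b := by
    intro b hb
    rw [mem_Ico] at hb
    have h : b ∈ Set.Iio (q + 1) := hb.2
    have hd := zeroExt_delete u x z (p := q + 1) (by omega) k (A := q) (l := b)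
      (K := Set.Iio (q + 1)) le_rfl (by simp)
    have hpre : skip (q + 1) ⁻¹' Set.Iio (q + 1) = Set.Iio (q + 1) := by
      ext v
      simp only [Set.mem_preimage, Set.mem_Iio]
      unfold skip; split_ifs <;> omega
    rw [hpre, hK, skip, if_pos hb.2] at hd
    rw [letterWt, if_pos (by omega), if_pos h, ascStep_of_lt (by omega),
      Set.insert_eq_of_mem h, stairLetterExt, stairLetterExt, zeroWt]
    linear_combination (z * u ^ q * x * u * if b = 0 then z else 1) * hd
  have h3 : z * u ^ q * x * (letterWt u x a (q + 1) (Set.Iio (q + 1)) *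
      ((if q + 1 = 0 then z else 1) * zeroExt u x z k (ascStep q a (q + 1)) (q + 1)
        (insert (q + 1) (Set.Iio (q + 1))))) = x * stairExt u x z k (q + 1) := by
    rw [letterWt, if_pos (by omega), if_neg (by simp), ascStep_of_lt (by omega),
      if_neg (by omega), hK, stairExt]
    ring
  have h4 := sum_range_add_sum_Ico (stairLetterExt u x z k q) (show a + 1 ≤ q + 1 by omega)
  rw [stairLetterExt, mul_assoc, zeroExt, letterSum, ← range_eq_Ico, sum_range_succ,
    ← sum_range_add_sum_Ico _ (show a + 1 ≤ q + 1 by omega), mul_add (z * u ^ q * x),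
    mul_add (z * u ^ q * x), mul_sum, mul_sum, sum_congr rfl h1, sum_congr rfl h2, h3,
    sum_add_distrib, ← mul_sum, ← mul_sum]
  linear_combination zeroWt z a * x * h4

theorem stairExt_eq_rminTail [IsDomain R] (u x z : R) (hu : u ≠ 0) (k : ℕ) :
    (∀ q, stairExt u x z k q = rminTail x u z k q) ∧
      ∀ q, ∀ a ≤ q, stairLetterExt u x z k q a = lastOneTotal x u z k q a := by
  induction k with
  | zero =>
    refine ⟨fun q => ?_, fun q a h => ?_⟩
    · rw [stairExt, zeroExt, rminTail, rminTotal_zero, mul_one]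
    · rw [stairLetterExt_zero, lastOneTotal_zero x u z hu h]
  | succ k ih =>
    obtain ⟨ihG, ihF⟩ := ih
    have hrange : ∀ q, ∑ b ∈ range (q + 1), stairLetterExt u x z k q b =
        ∑ b ∈ range (q + 1), lastOneTotal x u z k q b := fun q =>
      sum_congr rfl fun b hb => ihF q b (Nat.lt_succ_iff.1 (mem_range.1 hb))
    refine ⟨fun q => ?_, fun q a h => ?_⟩
    · rw [stairExt_succ, hrange, ihG, rminTail, rminTotal_succ]
    · have hIco : ∀ r, q ≤ r → ∑ b ∈ Ico (a + 1) (q + 1), stairLetterExt u x z k r b =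
          ∑ b ∈ Ico (a + 1) (q + 1), lastOneTotal x u z k r b := fun r hr =>
        sum_congr rfl fun b hb => ihF r b (by rw [mem_Ico] at hb; omega)
      rw [stairLetterExt_succ u x z k h, lastOneTotal_succ x u z hu k h, hrange, ihG, hIco q le_rfl,
        hIco (q + 1) (by omega), ← lastOneTotal_self, ← sum_Ico_succ_top (by omega)]

section Lists

theorem ascN_singleton (l : ℕ) : ascN [l] = 0 := by simp [ascN]

theorem ascN_cons_cons (l v : ℕ) (w : List ℕ) :
    ascN (l :: v :: w) = (if l < v then 1 else 0) + ascN (v :: w) := by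
  simp only [ascN, card_filter, List.length_cons, Nat.add_sub_cancel]
  rw [sum_range_succ', add_comm]
  simp

theorem ascN_le (s : List ℕ) : ascN s ≤ s.length - 1 :=
  (card_filter_le _ _).trans (card_range _).le

theorem zeroN_nil : zeroN [] = 0 := rfl

theorem zeroN_cons (v : ℕ) (w : List ℕ) : zeroN (v :: w) = zeroN w + if v = 0 then 1 else 0 := by
  simp only [zeroN, card_filter, List.length_cons]
  rw [sum_range_succ']
  simp

theorem zeroN_eq_zero_iff (w : List ℕ) : zeroN w = 0 ↔ ∀ y ∈ w, 0 < y := by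
  induction w with
  | nil => simp [zeroN_nil]
  | cons v w ih =>
    rw [zeroN_cons, List.forall_mem_cons, ← ih]
    split_ifs with h <;> simp [h, Nat.pos_iff_ne_zero]

theorem zeroN_le_length (w : List ℕ) : zeroN w ≤ w.length :=
  (card_filter_le _ _).trans (card_range _).le

theorem rminN_nil : rminN [] = 0 := rfl

theorem rminN_cons (v : ℕ) (w : List ℕ) :
    rminN (v :: w) = rminN w + if ∀ y ∈ w, v < y then 1 else 0 := by
  simp only [rminN, card_filter, List.length_cons]
  rw [sum_range_succ']
  congr 1
  · refine sum_congr rfl fun i _ => if_congr ?_ rfl rfl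
    constructor
    · intro h j hj hij
      simpa using h (j + 1) (by simpa using hj) (by omega)
    · intro h j hj hij
      obtain ⟨j, rfl⟩ : ∃ r, j = r + 1 := ⟨j - 1, by omega⟩
      simpa using h j (by simpa using hj) (by omega)
  · refine if_congr ?_ rfl rfl
    constructor
    · intro h y hy
      obtain ⟨j, hj, rfl⟩ := List.getElem_of_mem hy
      simpa [hj] using h (j + 1) (by simpa using hj) (by omega)
    · intro h j hj hij
      obtain ⟨j, rfl⟩ : ∃ r, j = r + 1 := ⟨j - 1, by omega⟩
      have hj' : j < w.length := by simpa using hj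
      simpa [hj'] using h w[j] (List.getElem_mem hj')

/-- The number of letters of `w` equal to `c` plus their position. -/
def matchCount (c : ℕ) (w : List ℕ) : ℕ :=
  ((range w.length).filter fun i => w.getD i 0 = c + i).card

theorem matchCount_cons (c v : ℕ) (w : List ℕ) :
    matchCount c (v :: w) = matchCount (c + 1) w + if v = c then 1 else 0 := by
  simp only [matchCount, card_filter, List.length_cons]
  rw [sum_range_succ']
  simp [add_comm, add_left_comm]

theorem matchCount_le_length (c : ℕ) (w : List ℕ) : matchCount c w ≤ w.length :=
  (card_filter_le _ _).trans (card_range _).le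

theorem maxN_cons_zero (w : List ℕ) : maxN (0 :: w) = matchCount 1 w + 1 := by
  have h : maxN (0 :: w) = matchCount 0 (0 :: w) := by simp [maxN, matchCount]
  rw [h, matchCount_cons, if_pos rfl]

/-- The words of length `m` that extend an ascent sequence with `A` ascents and last letter `l` to
an ascent sequence. -/
def words : ℕ → ℕ → ℕ → Finset (List ℕ)
  | 0, _, _ => {[]}
  | m + 1, A, l => (range (A + 2)).biUnion fun v => (words m (ascStep A l v) v).image (v :: ·)

theorem mem_words (m : ℕ) : ∀ {A l : ℕ} {w : List ℕ}, w ∈ words m A l ↔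
    w.length = m ∧ ∀ i < w.length, w.getD i 0 ≤ A + ascN (l :: w.take i) + 1 := by
  induction m with
  | zero =>
    intro A l w
    simp only [words, mem_singleton, List.length_eq_zero_iff]
    constructor
    · rintro rfl; simp
    · exact And.left
  | succ m ih =>
    intro A l w
    simp only [words, mem_biUnion, mem_range, mem_image, ih]
    constructor
    · rintro ⟨v, hv, w, ⟨hm, hw⟩, rfl⟩
      refine ⟨by simp [hm], fun i hi => ?_⟩
      cases i with
      | zero => simp; omega
      | succ i =>
        have := hw i (by simpa using hi)
        rw [List.take_succ_cons, ascN_cons_cons, List.getD_cons_succ]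
        unfold ascStep at this
        omega
    · rintro ⟨hm, hw⟩
      cases w with
      | nil => simp at hm
      | cons v w =>
        refine ⟨v, ?_, w, ⟨by simpa using hm, fun i hi => ?_⟩, rfl⟩
        · have := hw 0 (by simp)
          simp [ascN_singleton] at this
          omega
        · have := hw (i + 1) (by simpa using hi)
          rw [List.take_succ_cons, ascN_cons_cons, List.getD_cons_succ] at this
          unfold ascStep
          omega

theorem isAscSeq_cons_zero_iff (w : List ℕ) : IsAscSeq (0 :: w) ↔ w ∈ words w.length 0 0 := by
  rw [mem_words]
  constructor
  · rintro ⟨-, h⟩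
    refine ⟨rfl, fun i hi => ?_⟩
    simpa using h (i + 1) (by simpa using hi)
  · rintro ⟨-, h⟩
    have key : ∀ i < (0 :: w).length,
        (0 :: w).getD i 0 ≤ ascN ((0 :: w).take i) + 1 := by
      intro i hi
      cases i with
      | zero => simp
      | succ i => simpa using h i (by simpa using hi)
    refine ⟨fun i hi => ?_, key⟩
    cases i with
    | zero => simp
    | succ i =>
      have h1 := key (i + 1) hi
      have h2 := ascN_le ((0 :: w).take (i + 1))
      rw [List.length_take] at h2
      omega

theorem ascSeqs_succ (N : ℕ) : AscSeqs (N + 1) = ↑((words N 0 0).image (0 :: ·)) := by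
  ext s
  simp only [AscSeqs, Set.mem_ofPred_eq, coe_image, Set.mem_image, mem_coe]
  constructor
  · rintro ⟨hs, hN⟩
    cases s with
    | nil => simp at hN
    | cons v w =>
      obtain rfl : v = 0 := by simpa using hs.1 0 (by simp)
      obtain rfl : w.length = N := by simpa using hN
      exact ⟨w, (isAscSeq_cons_zero_iff w).1 hs, rfl⟩
  · rintro ⟨w, hw, rfl⟩
    obtain rfl := ((mem_words N).1 hw).1
    exact ⟨(isAscSeq_cons_zero_iff w).2 hw, by simp⟩

theorem matchCount_eq_zero (m : ℕ) : ∀ {A l c : ℕ} {w : List ℕ}, w ∈ words m A l → A + 1 < c →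
    matchCount c w = 0 := by
  induction m with
  | zero =>
    intro A l c w hw _
    obtain rfl := mem_singleton.1 hw
    rfl
  | succ m ih =>
    intro A l c w hw hc
    simp only [words, mem_biUnion, mem_range, mem_image] at hw
    obtain ⟨v, hv, w, hw, rfl⟩ := hw
    rw [matchCount_cons, if_neg (by omega), ih hw]
    unfold ascStep; split_ifs <;> omega

end Lists

theorem sum_words_succ (m A l : ℕ) (f : List ℕ → R) :
    ∑ w ∈ words (m + 1) A l, f w =
      ∑ v ∈ range (A + 2), ∑ w ∈ words m (ascStep A l v) v, f (v :: w) := by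
  rw [words, sum_biUnion]
  · exact sum_congr rfl fun v _ => sum_image fun w _ w' _ h => (List.cons.inj h).2
  · intro v _ v' _ hne
    rw [Function.onFun, disjoint_left]
    simp only [mem_image, not_exists, not_and]
    rintro _ ⟨w, -, rfl⟩ w' - h
    exact hne (List.cons.inj h).1.symm

/-- The weight of the word `w` after a letter `l` and a set of letters `K`. -/
noncomputable def wordWt (a b : R) : ℕ → Set ℕ → List ℕ → R
  | _, _, [] => 1
  | l, K, v :: w => letterWt a b l v K * wordWt a b v (insert v K) w

theorem wordWt_eq (a b : R) (w : List ℕ) : ∀ (l : ℕ) (K : Finset ℕ),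
    wordWt a b l ↑K w =
      a ^ ascN (l :: w) * b ^ (w.length + K.card - (K ∪ w.toFinset).card) := by
  induction w with
  | nil => intro l K; simp [wordWt, ascN_singleton]
  | cons v w ih =>
    intro l K
    have hle : (insert v K ∪ w.toFinset).card ≤ w.length + (insert v K).card := by
      have h1 := card_union_le (insert v K) w.toFinset
      have h2 := List.toFinset_card_le w
      omega
    have hunion : K ∪ (v :: w).toFinset = insert v K ∪ w.toFinset := by
      rw [List.toFinset_cons, union_insert, insert_union]
    rw [wordWt, ← coe_insert, ih, ascN_cons_cons, hunion, letterWt, pow_add, List.length_cons,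
      pow_ite, pow_one, pow_zero]
    by_cases hv : v ∈ K
    · rw [if_pos (mem_coe.2 hv)]
      rw [insert_eq_of_mem hv] at hle ⊢
      rw [show w.length + 1 + K.card - (K ∪ w.toFinset).card =
        w.length + K.card - (K ∪ w.toFinset).card + 1 by omega, pow_succ]
      ring
    · rw [if_neg (mt mem_coe.1 hv), card_insert_of_notMem hv,
        show w.length + (K.card + 1) = w.length + 1 + K.card by omega]
      ring

theorem wordWt_init (a b : R) (w : List ℕ) :
    wordWt a b 0 {0} w = a ^ ascN (0 :: w) * b ^ repN (0 :: w) := by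
  have h := wordWt_eq a b w 0 {0}
  rw [coe_singleton, card_singleton] at h
  rw [h, repN, ← List.card_toFinset, List.toFinset_cons, List.length_cons, insert_eq]

theorem zeroExt_eq_sum (u x z : R) (m : ℕ) : ∀ (A l : ℕ) (K : Set ℕ),
    zeroExt u x z m A l K = ∑ w ∈ words m A l, wordWt u x l K w * z ^ zeroN w := by
  induction m with
  | zero => intros; simp [zeroExt, words, wordWt, zeroN_nil]
  | succ m ih =>
    intro A l K
    rw [zeroExt, sum_words_succ, letterSum, ← range_eq_Ico]
    refine sum_congr rfl fun v _ => ?_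
    rw [ih, mul_sum, mul_sum]
    refine sum_congr rfl fun w _ => ?_
    rw [wordWt, zeroN_cons, pow_add, pow_ite, pow_one, pow_zero]
    ring

theorem stairExt_eq_sum_aux (u x z : R) (m t : ℕ) : ∀ c : ℕ,
    (∑ w ∈ words (t + m) c c, if t ≤ matchCount (c + 1) w then
      wordWt u x c (Set.Iio (c + 1)) w * z ^ zeroN w else 0) =
        u ^ t * zeroExt u x z m (c + t) (c + t) (Set.Iio (c + t + 1)) := by
  induction t with
  | zero => intro c; simp [zeroExt_eq_sum]
  | succ t ih =>
    intro c
    have hK : insert (c + 1) (Set.Iio (c + 1)) = Set.Iio (c + 1 + 1) := by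
      ext v; simp only [Set.mem_insert_iff, Set.mem_Iio]; omega
    have hwt : letterWt u x c (c + 1) (Set.Iio (c + 1)) = u := by simp [letterWt]
    rw [add_right_comm, sum_words_succ, sum_range_succ, sum_eq_zero, zero_add,
      ascStep_of_lt (by omega), show c + (t + 1) = c + 1 + t by omega, pow_succ', mul_assoc, ← ih,
      mul_sum]
    · refine sum_congr rfl fun w _ => ?_
      rw [matchCount_cons, if_pos rfl, if_congr Nat.add_le_add_iff_right rfl rfl, mul_ite, mul_zero,
        wordWt, hK, hwt, zeroN_cons, if_neg c.succ_ne_zero, add_zero, mul_assoc]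
    · intro v hv
      rw [mem_range] at hv
      rw [ascStep_of_le (by omega)]
      refine sum_eq_zero fun w hw => if_neg ?_
      rw [matchCount_cons, matchCount_eq_zero _ hw (by omega), if_neg (by omega)]
      omega

theorem stairExt_eq_sum (u x z : R) (k q : ℕ) :
    stairExt u x z k q = ∑ w ∈ words (q + k) 0 0, if q ≤ matchCount 1 w then
      wordWt u x 0 {0} w * z ^ zeroN (0 :: w) else 0 := by
  have hK : Set.Iio (0 + 1) = ({0} : Set ℕ) := by ext v; simp
  have h := stairExt_eq_sum_aux u x z k q 0
  rw [hK, zero_add, zero_add] at h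
  rw [stairExt, mul_assoc, ← h, mul_sum]
  refine sum_congr rfl fun w _ => ?_
  rw [zeroN_cons, if_pos rfl, mul_ite, mul_zero]
  congr 1
  ring

theorem rminExt_eq_sum (x u z : R) (m : ℕ) : ∀ (a c A l : ℕ) (K : Set ℕ), 1 ≤ c → 0 ∈ K →
    rminExt x u z m a c A l K =
      ∑ w ∈ words m A l, if zeroN w = a ∧ ∀ v ∈ w, v = 0 ∨ c ≤ v then
        wordWt x u l K w * z ^ rminN w else 0 := by
  induction m with
  | zero => intros; simp [rminExt, words, wordWt, zeroN_nil, rminN_nil, eq_comm]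
  | succ m ih =>
    intro a c A l K hc h0
    have hIco : Ico c (A + 2) = (range (A + 2)).filter (c ≤ ·) := by
      ext v; simp only [mem_Ico, mem_filter, mem_range]; omega
    rw [sum_words_succ]
    cases a with
    | zero =>
      rw [rminExt_succ_zero, letterSum, hIco, sum_filter]
      refine sum_congr rfl fun v _ => ?_
      split_ifs with hv
      · rw [ih _ _ _ _ _ hc (.inr h0), ih _ _ _ _ _ (by omega) (.inr h0), mul_sum,
          ← sum_add_distrib, mul_sum]
        refine sum_congr rfl fun w _ => ?_
        simp only [zeroN_cons, if_neg (show v ≠ 0 by omega), add_zero, wordWt, rminN_cons, pow_add,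
          pow_ite, pow_one, pow_zero, List.forall_mem_cons, hv, or_true, true_and]
        by_cases hz : zeroN w = 0
        · have hpos := (zeroN_eq_zero_iff w).1 hz
          by_cases hlt : ∀ y ∈ w, v < y
          · have h1 : ∀ y ∈ w, y = 0 ∨ c ≤ y := fun y hy => .inr (hv.trans (hlt y hy).le)
            have h2 : ∀ y ∈ w, y = 0 ∨ v + 1 ≤ y := fun y hy => .inr (hlt y hy)
            rw [if_pos ⟨hz, h1⟩, if_pos ⟨hz, h2⟩, if_pos ⟨hz, h1⟩, if_pos hlt]
            ring
          · have h2 : ¬ ∀ y ∈ w, y = 0 ∨ v + 1 ≤ y := fun h =>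
              hlt fun y hy => (h y hy).resolve_left (hpos y hy).ne'
            rw [if_neg (mt And.right h2), if_neg hlt]
            split_ifs <;> ring
        · simp [hz]
      · refine (sum_eq_zero fun w _ => if_neg ?_).symm
        rw [zeroN_cons, List.forall_mem_cons]
        rintro ⟨hz, hv', -⟩
        split_ifs at hz
        omega
    | succ a =>
      rw [rminExt_succ_succ, letterSum, hIco, sum_filter, sum_range_succ' _ (A + 1),
        if_neg (by omega), add_zero, sum_range_succ' _ (A + 1), ascStep_of_le (Nat.zero_le l),
        ih _ _ _ _ _ hc h0, mul_sum]
      congr 1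
      · refine sum_congr rfl fun v _ => ?_
        split_ifs with hv
        · rw [ih _ _ _ _ _ hc (.inr h0), mul_sum]
          refine sum_congr rfl fun w _ => ?_
          simp only [zeroN_cons, if_neg v.succ_ne_zero, add_zero, wordWt, rminN_cons,
            List.forall_mem_cons, hv, or_true, true_and, mul_ite, mul_zero]
          refine if_ctx_congr Iff.rfl (fun h => ?_) fun _ => rfl
          have hlt : ¬ ∀ y ∈ w, v + 1 < y := fun hlt => by
            have := (zeroN_eq_zero_iff w).2 fun y hy => (Nat.zero_le _).trans_lt (hlt y hy)
            omega
          rw [if_neg hlt, add_zero, mul_assoc]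
        · refine (sum_eq_zero fun w _ => if_neg ?_).symm
          rw [List.forall_mem_cons]
          omega
      · refine sum_congr rfl fun w _ => ?_
        have hwt : letterWt x u l 0 K = u := by simp [letterWt, h0]
        simp only [zeroN_cons, if_true, wordWt, hwt, Set.insert_eq_of_mem h0, rminN_cons, pow_add,
          pow_ite, pow_one, pow_zero, List.forall_mem_cons, true_or, true_and, mul_ite, mul_zero,
          Nat.add_right_cancel_iff]
        refine if_ctx_congr Iff.rfl (fun h => ?_) fun _ => rfl
        rw [zeroWt, ← h.1, if_congr (zeroN_eq_zero_iff w) rfl rfl]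
        split_ifs <;> ring

theorem rminTotal_eq_sum (x u z : R) (k q : ℕ) :
    rminTotal x u z k q = ∑ w ∈ words (q + k) 0 0, if zeroN w = q then
      wordWt x u 0 {0} w * z ^ rminN (0 :: w) else 0 := by
  rw [rminTotal, rminExt_eq_sum _ _ _ _ _ _ _ _ _ le_rfl (Set.mem_singleton 0), mul_sum]
  refine sum_congr rfl fun w _ => ?_
  rw [if_congr (and_iff_left fun v _ => by omega) rfl rfl, mul_ite, mul_zero]
  refine if_ctx_congr Iff.rfl (fun h => ?_) fun _ => rfl
  rw [rminN_cons, pow_add, pow_ite, pow_one, pow_zero, zeroWt, ← h,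
    if_congr (zeroN_eq_zero_iff w) rfl rfl]
  ring

theorem rminTail_eq_sum_words (x u z : R) (k : ℕ) : ∀ q : ℕ,
    rminTail x u z k q = ∑ w ∈ words (q + k) 0 0, if q ≤ zeroN w then
      wordWt x u 0 {0} w * z ^ rminN (0 :: w) else 0 := by
  induction k with
  | zero =>
    intro q
    rw [rminTail, rminTotal_eq_sum]
    refine sum_congr rfl fun w hw => if_congr ?_ rfl rfl
    have h1 := ((mem_words _).1 hw).1
    have h2 := zeroN_le_length w
    omega
  | succ k ih =>
    intro q
    rw [rminTail, rminTotal_eq_sum, ih, show q + 1 + k = q + (k + 1) by omega, ← sum_add_distrib]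
    refine sum_congr rfl fun w _ => ?_
    split_ifs <;> first | omega | simp

section Equidistribution

open MvPolynomial

theorem coeff_X_pow_mul (a b c a' b' c' : ℕ) :
    coeff (Finsupp.single 0 a' + Finsupp.single 1 b' + Finsupp.single 2 c')
      (X 0 ^ a * X 1 ^ b * X 2 ^ c : MvPolynomial (Fin 3) ℤ) =
        if (a, b, c) = (a', b', c') then 1 else 0 := by
  simp only [X_pow_eq_monomial, monomial_mul, mul_one, coeff_monomial]
  refine if_congr ⟨fun h => ?_, fun h => ?_⟩ rfl rfl
  · have h0 := DFunLike.congr_fun h 0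
    have h1 := DFunLike.congr_fun h 1
    have h2 := DFunLike.congr_fun h 2
    simp at h0 h1 h2
    simp [h0, h1, h2]
  · simp only [Prod.mk.injEq] at h
    obtain ⟨rfl, rfl, rfl⟩ := h
    rfl

theorem card_filter_eq_of_sum_eq {α : Type*} (S T : Finset α) (f g : α → ℕ × ℕ × ℕ)
    (h : ∑ s ∈ S, (X 0 ^ (f s).1 * X 1 ^ (f s).2.1 * X 2 ^ (f s).2.2 : MvPolynomial (Fin 3) ℤ) =
      ∑ s ∈ T, X 0 ^ (g s).1 * X 1 ^ (g s).2.1 * X 2 ^ (g s).2.2) (t : ℕ × ℕ × ℕ) :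
    #{s ∈ S | f s = t} = #{s ∈ T | g s = t} := by
  have h' := congrArg (coeff (Finsupp.single 0 t.1 + Finsupp.single 1 t.2.1 +
    Finsupp.single 2 t.2.2)) h
  simp only [coeff_sum, coeff_X_pow_mul, Prod.mk.eta, sum_boole] at h'
  exact_mod_cast h'

/-- The statistics `asc`, `rep` and `zero`. -/
def ascStats (s : List ℕ) : ℕ × ℕ × ℕ := (ascN s, repN s, zeroN s)

/-- The statistics `rep`, `asc` and `rmin`. -/
def repStats (s : List ℕ) : ℕ × ℕ × ℕ := (repN s, ascN s, rminN s)

theorem sum_words_le_matchCount [IsDomain R] (u x z : R) (hu : u ≠ 0) (N q : ℕ) :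
    (∑ w ∈ words N 0 0 with q ≤ matchCount 1 w,
      u ^ ascN (0 :: w) * x ^ repN (0 :: w) * z ^ zeroN (0 :: w)) =
      ∑ w ∈ words N 0 0 with q ≤ zeroN w,
        u ^ repN (0 :: w) * x ^ ascN (0 :: w) * z ^ rminN (0 :: w) := by
  rw [sum_filter, sum_filter]
  rcases le_or_gt q N with hq | hq
  · obtain ⟨k, rfl⟩ := Nat.exists_eq_add_of_le hq
    have h := (stairExt_eq_rminTail u x z hu k).1 q
    rw [stairExt_eq_sum, rminTail_eq_sum_words] at h
    simpa only [wordWt_init, mul_comm (x ^ ascN _)] using h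
  · rw [sum_eq_zero, sum_eq_zero]
    · intro w hw
      have := (zeroN_le_length w).trans_eq ((mem_words N).1 hw).1
      exact if_neg (by omega)
    · intro w hw
      have := (matchCount_le_length 1 w).trans_eq ((mem_words N).1 hw).1
      exact if_neg (by omega)

theorem card_filter_le_matchCount (N q : ℕ) (t : ℕ × ℕ × ℕ) :
    #{w ∈ words N 0 0 | q ≤ matchCount 1 w ∧ ascStats (0 :: w) = t} =
      #{w ∈ words N 0 0 | q ≤ zeroN w ∧ repStats (0 :: w) = t} := by
  rw [← filter_filter, ← filter_filter]
  exact card_filter_eq_of_sum_eq _ _ (fun w => ascStats (0 :: w)) (fun w => repStats (0 :: w))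
    (sum_words_le_matchCount _ _ _ (X_ne_zero 0) N q) t

theorem card_filter_eq_add {α : Type*} (S : Finset α) (f : α → ℕ) (p : α → Prop) [DecidablePred p]
    (q : ℕ) : #{s ∈ S | q ≤ f s ∧ p s} =
      #{s ∈ S | f s = q ∧ p s} + #{s ∈ S | q + 1 ≤ f s ∧ p s} := by
  simp only [card_filter, ← sum_add_distrib]
  refine sum_congr rfl fun s _ => ?_
  by_cases hp : p s
  · simp only [hp, and_true]
    split_ifs <;> omega
  · simp [hp]

theorem card_filter_matchCount (N q : ℕ) (t : ℕ × ℕ × ℕ) :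
    #{w ∈ words N 0 0 | matchCount 1 w = q ∧ ascStats (0 :: w) = t} =
      #{w ∈ words N 0 0 | zeroN w = q ∧ repStats (0 :: w) = t} := by
  have h := card_filter_le_matchCount N q t
  rw [card_filter_eq_add, card_filter_eq_add _ zeroN, card_filter_le_matchCount N (q + 1)] at h
  exact Nat.add_right_cancel h

theorem card_filter_words (N : ℕ) (t : ℕ × ℕ × ℕ × ℕ) :
    #{s ∈ (words N 0 0).image (0 :: ·) | (maxN s, ascStats s) = t} =
      #{s ∈ (words N 0 0).image (0 :: ·) | (zeroN s, repStats s) = t} := by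
  obtain ⟨q, t⟩ := t
  have hinj : Function.Injective (fun w : List ℕ => 0 :: w) := List.cons_injective
  rw [filter_image, filter_image, card_image_of_injective _ hinj, card_image_of_injective _ hinj]
  simp only [Prod.mk.injEq, maxN_cons_zero, zeroN_cons, if_true]
  cases q with
  | zero => simp
  | succ q => simpa only [Nat.add_right_cancel_iff] using card_filter_matchCount N q t

end Equidistribution

theorem exists_bijOn_of_card_filter_eq {α β : Type*} [DecidableEq β] [Nonempty α] (S : Finset α)
    (f g : α → β) (h : ∀ t, #{s ∈ S | f s = t} = #{s ∈ S | g s = t}) :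
    ∃ φ : α → α, Set.BijOn φ S S ∧ ∀ s ∈ S, f s = g (φ s) := by
  have key (t : β) : ∃ φ : α → α,
      Set.BijOn φ ↑{s ∈ S | f s = t} ↑{s ∈ S | g s = t} :=
    (finite_toSet _).exists_bijOn_of_encard_eq
      (by rw [Set.encard_coe_eq_coe_finsetCard, Set.encard_coe_eq_coe_finsetCard, h])
  choose φ hφ using key
  have hmaps {s : α} (hs : s ∈ S) : φ (f s) s ∈ S ∧ g (φ (f s) s) = f s := by
    simpa using (hφ (f s)).mapsTo (x := s) (by simpa using hs)
  refine ⟨fun s => φ (f s) s, ⟨fun s hs => (hmaps hs).1, fun s hs s' hs' hss => ?_,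
    fun s hs => ?_⟩, fun s hs => (hmaps hs).2.symm⟩
  · have hf : f s = f s' := by
      rw [← (hmaps hs).2, ← (hmaps hs').2]
      exact congrArg g hss
    refine (hφ (f s)).injOn (by simpa using hs) (by simpa [hf] using hs') ?_
    simpa only [← hf] using hss
  · obtain ⟨s', hs', hss⟩ := (hφ (g s)).surjOn (a := s) (by simpa using hs)
    rw [mem_coe, mem_filter] at hs'
    exact ⟨s', hs'.1, by simpa only [hs'.2] using hss⟩

end Transfer

/-- There is a bijection `Υ` on ascent sequences of length `n` transforming
`(asc, rep, zero, max)` into `(rep, asc, rmin, zero)`. -/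
theorem exists_Upsilon (n : ℕ) (hn : 1 ≤ n) :
    ∃ Υ : List ℕ → List ℕ, Set.BijOn Υ (AscSeqs n) (AscSeqs n) ∧
      ∀ s ∈ AscSeqs n,
        ascN s = repN (Υ s) ∧ repN s = ascN (Υ s) ∧
        zeroN s = rminN (Υ s) ∧ maxN s = zeroN (Υ s) := by
  obtain ⟨N, rfl⟩ := Nat.exists_eq_add_of_le' hn
  obtain ⟨φ, hφ, h⟩ := exists_bijOn_of_card_filter_eq ((words N 0 0).image (0 :: ·))
    (fun s => (maxN s, ascStats s)) (fun s => (zeroN s, repStats s)) (card_filter_words N)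
  rw [ascSeqs_succ]
  refine ⟨φ, hφ, fun s hs => ?_⟩
  have hs' := h s hs
  simp only [ascStats, repStats, Prod.mk.injEq] at hs'
  exact ⟨hs'.2.1, hs'.2.2.1, hs'.2.2.2, hs'.1⟩
end
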